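/- arXiv:2411.16628 — 3 statements merged into one kernel-verified Lean document; each statement's English description precedes it below -/
import Mathlib

section
/- Under the standing setting, assumption (H4'), and the two limit assumptions on ν_t, for every φ ∈ C¹(M) the series Σ_{k=0}^∞ ν̃(φ∘F₀^k) converges absolutely and lim_{t→0⁺} (μ_t(φ) − μ₀(φ))/t = Σ_{k=0}^∞ ν̃(φ∘F₀^k), where μ₀(φ) = ∫_M φ h₀ dm. -/
open MeasureTheory Filter Topology Set

noncomputable section

/-- The open unit square `M = (0,1)²`. -/
def unitOpenSq : Set (ℝ × ℝ) := Set.Ioo (0:ℝ) 1 ×ˢ Set.Ioo (0:ℝ) 1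

/-- The closed unit square `[0,1]²`. -/
def unitSq : Set (ℝ × ℝ) := Set.Icc (0:ℝ) 1 ×ˢ Set.Icc (0:ℝ) 1

/-- The `C¹` norm of `φ`: supremum over `[0,1]²` of `max |φ| ‖Dφ‖`. -/
def C1norm (φ : ℝ × ℝ → ℝ) : ℝ :=
  sSup ((fun x => max |φ x| ‖fderiv ℝ φ x‖) '' unitSq)

/-- A continuous observable of an iterate of a measurable self-map of `M`, multiplied by an
integrable density, is integrable on `M`. -/
theorem integrableOn_comp_iterate_mul {f : ℝ × ℝ → ℝ × ℝ} (hf : Measurable f)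
    (hmaps : MapsTo f unitOpenSq unitOpenSq) {h : ℝ × ℝ → ℝ} (hh : IntegrableOn h unitOpenSq)
    {φ : ℝ × ℝ → ℝ} (hφ : Continuous φ) (n : ℕ) :
    IntegrableOn (fun x => φ (f^[n] x) * h x) unitOpenSq := by
  obtain ⟨B, hB⟩ := ((isCompact_Icc (a := (0 : ℝ)) (b := 1)).prod
    (isCompact_Icc (a := (0 : ℝ)) (b := 1))).exists_bound_of_continuousOn hφ.continuousOn
  have hmeas : MeasurableSet unitOpenSq := measurableSet_Ioo.prod measurableSet_Ioo
  refine Integrable.bdd_mul (c := B) hh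
    (hφ.measurable.comp (hf.iterate n)).aestronglyMeasurable ?_
  filter_upwards [ae_restrict_mem hmeas] with x hx
  exact hB _ (prod_mono Ioo_subset_Icc_self Ioo_subset_Icc_self (hmaps.iterate n hx))

/-- Linear response.  The signed measure `ν̃` is encoded by a pair of finite
measures `νp, νm` supported on `[0,1]²`, with `ν̃(φ) = ∫ φ dνp − ∫ φ dνm`. -/
theorem linear_response_of_physical_measure
    (ε : ℝ) (hε : 0 < ε)
    (F : ℝ → ℝ × ℝ → ℝ × ℝ)
    (hFmeas : ∀ t ∈ Set.Icc (0:ℝ) ε, Measurable (F t))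
    (hFmaps : ∀ t ∈ Set.Icc (0:ℝ) ε, Set.MapsTo (F t) unitOpenSq unitOpenSq)
    (h₀ : ℝ × ℝ → ℝ)
    (h₀meas : Measurable h₀)
    (h₀C2 : ContDiffOn ℝ 2 h₀ unitSq)
    (h₀nonneg : ∀ x ∈ unitOpenSq, 0 ≤ h₀ x)
    (h₀prob : ∫ x in unitOpenSq, h₀ x = 1)
    (h₀inv : ∀ φ : ℝ × ℝ → ℝ, Measurable φ → (∃ B : ℝ, ∀ x ∈ unitOpenSq, |φ x| ≤ B) →
      ∫ x in unitOpenSq, φ (F 0 x) * h₀ x = ∫ x in unitOpenSq, φ x * h₀ x)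
    (μ : ℝ → (ℝ × ℝ → ℝ) → ℝ)
    (hμ : ∀ t ∈ Set.Icc (0:ℝ) ε, ∀ φ : ℝ × ℝ → ℝ, Continuous φ →
      Tendsto (fun n : ℕ => ∫ x in unitOpenSq, φ ((F t)^[n] x) * h₀ x) atTop (𝓝 (μ t φ)))
    (C : ℝ) (hC : 0 < C)
    (Θ : ℕ → ℝ) (hΘ : ∀ n, 0 ≤ Θ n) (hΘsum : Summable Θ)
    (hH4' : ∀ t ∈ Set.Ioc (0:ℝ) ε, ∀ n : ℕ, ∀ φ : ℝ × ℝ → ℝ, ContDiff ℝ 1 φ →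
      |∫ x in unitOpenSq, (φ ((F t)^[n+1] x) - φ ((F t)^[n] x)) * h₀ x|
        ≤ C * Θ n * C1norm φ * t)
    (νp νm : Measure (ℝ × ℝ)) [IsFiniteMeasure νp] [IsFiniteMeasure νm]
    (hνpsupp : νp unitSqᶜ = 0) (hνmsupp : νm unitSqᶜ = 0)
    (hν : ∀ φ : ℝ × ℝ → ℝ, Continuous φ →
      Tendsto (fun t : ℝ => (∫ x in unitOpenSq, (φ (F t x) - φ x) * h₀ x) / t)
        (𝓝[>] (0:ℝ)) (𝓝 ((∫ x, φ x ∂νp) - ∫ x, φ x ∂νm)))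
    (hνk : ∀ k : ℕ, ∀ φ : ℝ × ℝ → ℝ, ContDiff ℝ 1 φ →
      Tendsto (fun t : ℝ =>
          (∫ x in unitOpenSq, (φ ((F t)^[k+1] x) - φ ((F t)^[k] x)) * h₀ x) / t)
        (𝓝[>] (0:ℝ))
        (𝓝 ((∫ x, φ ((F 0)^[k] x) ∂νp) - ∫ x, φ ((F 0)^[k] x) ∂νm))) :
    ∀ φ : ℝ × ℝ → ℝ, ContDiff ℝ 1 φ →
      Summable (fun k : ℕ => |(∫ x, φ ((F 0)^[k] x) ∂νp) - ∫ x, φ ((F 0)^[k] x) ∂νm|) ∧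
      Tendsto (fun t : ℝ => (μ t φ - ∫ x in unitOpenSq, φ x * h₀ x) / t) (𝓝[>] (0:ℝ))
        (𝓝 (∑' k : ℕ, ((∫ x, φ ((F 0)^[k] x) ∂νp) - ∫ x, φ ((F 0)^[k] x) ∂νm))) := by
  intro φ hφ
  let a : ℕ → ℝ := fun k => (∫ x, φ ((F 0)^[k] x) ∂νp) - ∫ x, φ ((F 0)^[k] x) ∂νm
  let I : ℝ → ℕ → ℝ := fun t k =>
    ∫ x in unitOpenSq, (φ ((F t)^[k+1] x) - φ ((F t)^[k] x)) * h₀ x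
  let b : ℕ → ℝ := fun k => C * Θ k * C1norm φ
  have hb : Summable b := (hΘsum.mul_left C).mul_right _
  have hIoc : ∀ᶠ t in 𝓝[>] (0 : ℝ), t ∈ Ioc 0 ε := Ioc_mem_nhdsGT hε
  have hbound : ∀ t ∈ Ioc 0 ε, ∀ k, |I t k / t| ≤ b k := fun t ht k => by
    rw [abs_div, abs_of_pos ht.1, div_le_iff₀ ht.1]
    exact hH4' t ht k φ hφ
  have hab : ∀ k, |a k| ≤ b k := fun k =>
    le_of_tendsto (hνk k φ hφ).abs (hIoc.mono fun t ht => hbound t ht k)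
  have hint : IntegrableOn h₀ unitOpenSq :=
    not_imp_comm.1 integral_undef (by rw [h₀prob]; exact one_ne_zero)
  refine ⟨Summable.of_nonneg_of_le (fun k => abs_nonneg _) hab hb, ?_⟩
  have hsum : ∀ t ∈ Ioc 0 ε,
      ∑' k, I t k / t = (μ t φ - ∫ x in unitOpenSq, φ x * h₀ x) / t := fun t ht => by
    have htc : t ∈ Icc 0 ε := Ioc_subset_Icc_self ht
    have hI : ∀ k, I t k = (∫ x in unitOpenSq, φ ((F t)^[k+1] x) * h₀ x)
        - ∫ x in unitOpenSq, φ ((F t)^[k] x) * h₀ x := fun k => by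
      have hk := integrableOn_comp_iterate_mul (hFmeas t htc) (hFmaps t htc) hint hφ.continuous
      simp only [I, sub_mul]
      exact integral_sub (hk (k + 1)) (hk k)
    have htel : ∀ n, ∑ k ∈ Finset.range n, I t k / t
        = ((∫ x in unitOpenSq, φ ((F t)^[n] x) * h₀ x) - ∫ x in unitOpenSq, φ x * h₀ x) / t :=
      fun n => by
        rw [← Finset.sum_div, Finset.sum_congr rfl fun k _ => hI k,
          Finset.sum_range_sub fun k => ∫ x in unitOpenSq, φ ((F t)^[k] x) * h₀ x]
        rfl
    have hs : Summable fun k => I t k / t := Summable.of_norm_bounded hb (hbound t ht)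
    refine tendsto_nhds_unique hs.hasSum.tendsto_sum_nat ?_
    simp only [htel]
    exact ((hμ t htc φ hφ.continuous).sub_const _).div_const t
  refine (tendsto_tsum_of_dominated_convergence hb (fun k => hνk k φ hφ)
    (hIoc.mono fun t ht => hbound t ht)).congr' (hIoc.mono hsum)
end
end

section
/- There exists ε₀ ∈ (0,1/8] such that for every t ∈ (0,ε₀] the limit μ_t(φ) := lim_{n→∞} ∫_M (φ∘F_t^n) dm exists for every continuous φ : [0,1]² → ℝ, and for every φ ∈ C¹(M) the series Σ_{k=0}^∞ [∫_M φ dm − ∫₀¹ φ(F₀^k(s,s)) ds] converges absolutely and lim_{t→0⁺} (μ_t(φ) − ∫_M φ dm)/t = Σ_{k=0}^∞ [∫_M φ dm − ∫₀¹ φ(F₀^k(s,s)) ds]. -/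
open MeasureTheory Filter Topology Set

noncomputable section

/-- The perturbed Arnold cat map `F_t(x,y) = ({x+y}, {x+(2−t)y})`. -/
def catF (t : ℝ) (p : ℝ × ℝ) : ℝ × ℝ :=
  (Int.fract (p.1 + p.2), Int.fract (p.1 + (2 - t) * p.2))

/-- The Koopman operator of `catF t`, acting on `ℤ²`-periodic functions of two real variables. -/
def koop (t : ℝ) (Ψ : ℝ → ℝ → ℝ) : ℝ → ℝ → ℝ :=
  fun x y => Ψ (x + Int.fract y) (x + (2 - t) * Int.fract y)

/-- Measurable `ℤ²`-periodic functions bounded by `B`. -/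
structure PerBdd (Ψ : ℝ → ℝ → ℝ) (B : ℝ) : Prop where
  meas : Measurable (Function.uncurry Ψ)
  bdd : ∀ x y, |Ψ x y| ≤ B
  perx : ∀ x y, Ψ (x + 1) y = Ψ x y
  pery : ∀ x y, Ψ x (y + 1) = Ψ x y

/-- The integral of `Ψ` along the segment `x = a + ξ y`, `y₀ ≤ y ≤ y₁`, with respect to `dy`. -/
def line (Ψ : ℝ → ℝ → ℝ) (ξ a y₀ y₁ : ℝ) : ℝ := ∫ y in y₀..y₁, Ψ (a + ξ * y) y

/-- The expansion factor, in the `y` coordinate, of the direction `(ξ, 1)`. -/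
def stretch (t ξ : ℝ) : ℝ := ξ + 2 - t

/-- The action of the linear part of `catF t` on directions `(ξ, 1)`. -/
def dir (t ξ : ℝ) : ℝ := (ξ + 1) / stretch t ξ

/-- The invariant cone of directions. -/
def cone : Set ℝ := Icc (3 / 5) 1

/-- The range of perturbation parameters. -/
def params : Set ℝ := Icc 0 (1 / 100)

namespace PerBdd

variable {Ψ : ℝ → ℝ → ℝ} {B : ℝ}

lemma koop (h : PerBdd Ψ B) (t : ℝ) : PerBdd (koop t Ψ) B where
  meas := by
    have : Measurable fun p : ℝ × ℝ =>
        (p.1 + Int.fract p.2, p.1 + (2 - t) * Int.fract p.2) := by fun_prop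
    exact h.meas.comp this
  bdd x y := h.bdd _ _
  perx x y := by
    unfold _root_.koop
    rw [← h.perx (x + _), ← h.pery _ (x + _)]
    congr 1 <;> ring
  pery x y := by
    unfold _root_.koop
    rw [Int.fract_add_one]

lemma iterate (h : PerBdd Ψ B) (t : ℝ) (n : ℕ) : PerBdd ((_root_.koop t)^[n] Ψ) B := by
  induction n with
  | zero => exact h
  | succ n ih => rw [Function.iterate_succ_apply']; exact ih.koop t

lemma perx_int (h : PerBdd Ψ B) (x y : ℝ) (k : ℤ) : Ψ (x + k) y = Ψ x y := by
  have : Function.Periodic (fun x => Ψ x y) 1 := fun x => h.perx x y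
  simpa using this.int_mul k x

lemma pery_int (h : PerBdd Ψ B) (x y : ℝ) (k : ℤ) : Ψ x (y + k) = Ψ x y := by
  have : Function.Periodic (fun y => Ψ x y) 1 := fun y => h.pery x y
  simpa using this.int_mul k y

lemma nonneg (h : PerBdd Ψ B) : 0 ≤ B := (abs_nonneg _).trans (h.bdd 0 0)

lemma intervalIntegrable (h : PerBdd Ψ B) {f g : ℝ → ℝ} (hf : Measurable f) (hg : Measurable g)
    (u v : ℝ) : IntervalIntegrable (fun y => Ψ (f y) (g y)) volume u v := by
  have hm : Measurable fun y => Ψ (f y) (g y) := h.meas.comp (hf.prodMk hg)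
  refine (intervalIntegrable_const (c := B)).mono_fun hm.aestronglyMeasurable ?_
  refine Eventually.of_forall fun y => ?_
  simpa [abs_of_nonneg h.nonneg] using h.bdd (f y) (g y)

lemma line_add (h : PerBdd Ψ B) (ξ a u v w : ℝ) :
    line Ψ ξ a u v + line Ψ ξ a v w = line Ψ ξ a u w :=
  intervalIntegral.integral_add_adjacent_intervals
    (h.intervalIntegrable (by fun_prop) (by fun_prop) _ _)
    (h.intervalIntegrable (by fun_prop) (by fun_prop) _ _)

lemma line_shift (h : PerBdd Ψ B) (ξ a u v : ℝ) (k : ℤ) :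
    line Ψ ξ (a + ξ * k) u v = line Ψ ξ a (u + k) (v + k) := by
  unfold line
  rw [← intervalIntegral.integral_comp_add_right]
  congr 1; ext y
  rw [h.pery_int]; congr 1; ring

lemma line_shift' (h : PerBdd Ψ B) (ξ a u v : ℝ) (k : ℤ) :
    line Ψ ξ a u v = line Ψ ξ (a + ξ * k) (u - k) (v - k) := by
  rw [h.line_shift]; simp

lemma line_add_int (h : PerBdd Ψ B) (ξ a u v : ℝ) (k : ℤ) :
    line Ψ ξ (a + k) u v = line Ψ ξ a u v := by
  unfold line
  congr 1; ext y
  rw [← h.perx_int (a + ξ * y) y k]; congr 1; ring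

lemma abs_line_le (h : PerBdd Ψ B) (ξ a : ℝ) {u v : ℝ} (huv : u ≤ v) :
    |line Ψ ξ a u v| ≤ B * (v - u) := by
  have := intervalIntegral.norm_integral_le_of_norm_le_const (a := u) (b := v) (C := B)
    (f := fun y => Ψ (a + ξ * y) y) (fun y _ => h.bdd _ _)
  rwa [abs_of_nonneg (sub_nonneg.2 huv)] at this

end PerBdd

lemma stretch_bounds {t ξ : ℝ} (ht : t ∈ params) (hξ : ξ ∈ cone) :
    259 / 100 ≤ stretch t ξ ∧ stretch t ξ ≤ 3 := by
  obtain ⟨h1, h2⟩ := ht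
  obtain ⟨h3, h4⟩ := hξ
  constructor <;> unfold stretch <;> linarith

lemma stretch_pos {t ξ : ℝ} (ht : t ∈ params) (hξ : ξ ∈ cone) : 0 < stretch t ξ := by
  linarith [(stretch_bounds ht hξ).1]

lemma dir_mem {t ξ : ℝ} (ht : t ∈ params) (hξ : ξ ∈ cone) : dir t ξ ∈ cone := by
  have hp := stretch_pos ht hξ
  obtain ⟨h1, h2⟩ := ht
  obtain ⟨h3, h4⟩ := hξ
  constructor
  · rw [dir, le_div_iff₀ hp]; unfold stretch; linarith
  · rw [dir, div_le_one hp]; unfold stretch; linarith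

lemma dir_iterate_mem {t ξ : ℝ} (ht : t ∈ params) (hξ : ξ ∈ cone) (n : ℕ) :
    (dir t)^[n] ξ ∈ cone := by
  induction n with
  | zero => exact hξ
  | succ n ih => rw [Function.iterate_succ_apply']; exact dir_mem ht ih

lemma line_koop {t ξ : ℝ} (ht : t ∈ params) (hξ : ξ ∈ cone) (Ψ : ℝ → ℝ → ℝ) (a : ℝ) {y₀ y₁ : ℝ}
    (h0 : 0 ≤ y₀) (h01 : y₀ ≤ y₁) (h1 : y₁ ≤ 1) :
    line (koop t Ψ) ξ a y₀ y₁ = (stretch t ξ)⁻¹ *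
      line Ψ (dir t ξ) (a * (1 - dir t ξ)) (a + stretch t ξ * y₀) (a + stretch t ξ * y₁) := by
  have hp := stretch_pos ht hξ
  unfold line
  rw [← smul_eq_mul, ← intervalIntegral.integral_comp_add_mul _ hp.ne']
  refine intervalIntegral.integral_congr_Ioo_of_le h01 fun y hy => ?_
  have hy' : Int.fract y = y := Int.fract_eq_self.2 ⟨h0.trans hy.1.le, hy.2.trans_le h1⟩
  simp only [koop, hy']
  congr 1
  · unfold dir
    field_simp
    unfold stretch
    ring
  · unfold stretch
    ring

/-- Integrals of `Ψ` over segments of direction `ξ` in the strip `0 ≤ y ≤ 1` are close to `c` times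
the length. -/
def NearConst (Ψ : ℝ → ℝ → ℝ) (ξ c A B : ℝ) : Prop :=
  ∀ a y₀ y₁, 0 ≤ y₀ → y₀ ≤ y₁ → y₁ ≤ 1 →
    |line Ψ ξ a y₀ y₁ - c * (y₁ - y₀)| ≤ A * (y₁ - y₀) + B * √(y₁ - y₀)

/-- Hölder dependence of the integral of `Ψ` over a segment of direction `ξ` in the strip
`0 ≤ y ≤ 1`, when the segment is translated by a multiple of `(κ, -1)`. -/
def TransHolder (Ψ : ℝ → ℝ → ℝ) (ξ κ P : ℝ) : Prop :=
  ∀ a d y₀ y₁, 0 ≤ d → d ≤ y₀ → y₀ ≤ y₁ → y₁ ≤ 1 →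
    |line Ψ ξ a y₀ y₁ - line Ψ ξ (a + (ξ + κ) * d) (y₀ - d) (y₁ - d)| ≤ P * √d

/-- `(κ, -1)` is a stable eigenvector of the linear part of `catF t`, with eigenvalue
`2 - t - κ`. -/
structure IsStable (t κ : ℝ) : Prop where
  eq : κ ^ 2 = (1 - t) * κ + 1
  pos : 0 < κ
  le_two : κ ≤ 2
  eig_nonneg : 0 ≤ 2 - t - κ
  eig_le : 2 - t - κ ≤ 382 / 1000

lemma exists_isStable {t : ℝ} (ht : t ∈ params) : ∃ κ, IsStable t κ := by
  obtain ⟨h0, h1⟩ := ht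
  set r := √((1 - t) ^ 2 + 4) with hr
  have hsq : r ^ 2 = (1 - t) ^ 2 + 4 := Real.sq_sqrt (by positivity)
  have hr0 : 0 ≤ r := Real.sqrt_nonneg _
  refine ⟨((1 - t) + r) / 2, by linear_combination hsq / 4, by linarith, ?_, ?_, ?_⟩
  · nlinarith
  · nlinarith
  · nlinarith

lemma sqrt_add_sqrt_le {p q : ℝ} (hp : 0 ≤ p) (hq : 0 ≤ q) : √p + √q ≤ √(2 * (p + q)) := by
  apply Real.le_sqrt_of_sq_le
  nlinarith [Real.sq_sqrt hp, Real.sq_sqrt hq, sq_nonneg (√p - √q)]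

namespace NearConst

variable {Ψ : ℝ → ℝ → ℝ} {M ξ c A B : ℝ}

lemma cell (hΨ : PerBdd Ψ M) (h : NearConst Ψ ξ c A B) (a : ℝ) {y₀ y₁ : ℝ} (k : ℤ)
    (h0 : k ≤ y₀) (h01 : y₀ ≤ y₁) (h1 : y₁ ≤ k + 1) :
    |line Ψ ξ a y₀ y₁ - c * (y₁ - y₀)| ≤ A * (y₁ - y₀) + B * √(y₁ - y₀) := by
  have := h (a + ξ * k) (y₀ - k) (y₁ - k) (by linarith) (by linarith) (by linarith)
  rwa [← hΨ.line_shift', sub_sub_sub_cancel_right] at this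

lemma cells (hΨ : PerBdd Ψ M) (h : NearConst Ψ ξ c A B) (a : ℝ) (k : ℤ) (n : ℕ) :
    |line Ψ ξ a k (k + n) - c * n| ≤ (A + B) * n := by
  induction n with
  | zero => simp [line]
  | succ n ih =>
    have := h.cell hΨ a (y₀ := k + n) (y₁ := k + n + 1) (k + n) (by simp) (by simp) (by simp)
    rw [← hΨ.line_add ξ a _ (k + n) _]
    push_cast
    rw [add_sub_cancel_left, Real.sqrt_one] at this
    rw [← add_assoc]
    rw [abs_le] at *
    constructor <;> linarith

lemma extend (hΨ : PerBdd Ψ M) (h : NearConst Ψ ξ c A B) (hB : 0 ≤ B) (a : ℝ) {y₀ y₁ : ℝ}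
    (h01 : y₀ ≤ y₁) :
    |line Ψ ξ a y₀ y₁ - c * (y₁ - y₀)| ≤ (A + B) * (y₁ - y₀) + B * √(2 * (y₁ - y₀)) := by
  have f0 := Int.floor_le y₀
  have f0' := Int.lt_floor_add_one y₀
  have f1 := Int.floor_le y₁
  have f1' := Int.lt_floor_add_one y₁
  rcases (Int.floor_le_floor h01).eq_or_lt with hk | hk
  · have := h.cell hΨ a ⌊y₀⌋ f0 h01 (by rw [hk]; exact f1'.le)
    have h2 : √(y₁ - y₀) ≤ √(2 * (y₁ - y₀)) := Real.sqrt_le_sqrt (by linarith)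
    have := mul_le_mul_of_nonneg_left h2 hB
    have := mul_nonneg hB (sub_nonneg.2 h01)
    linarith
  · obtain ⟨n, hn⟩ := Int.le.dest (Int.add_one_le_iff.2 hk)
    have hn' : (⌊y₁⌋ : ℝ) = ⌊y₀⌋ + 1 + n := by rw [← hn]; push_cast; ring
    have e1 := h.cell hΨ a ⌊y₀⌋ f0 f0'.le le_rfl
    have e2 := h.cells hΨ a (⌊y₀⌋ + 1) n
    have e3 := h.cell hΨ a ⌊y₁⌋ le_rfl f1 f1'.le
    push_cast at e2
    rw [← hn'] at e2
    rw [← hΨ.line_add ξ a _ (⌊y₀⌋ + 1) _, ← hΨ.line_add ξ a (⌊y₀⌋ + 1) ⌊y₁⌋ _]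
    set p := (⌊y₀⌋ : ℝ) + 1 - y₀ with hp
    set q := y₁ - (⌊y₁⌋ : ℝ) with hq
    have hpq : y₁ - y₀ = p + q + n := by rw [hp, hq, hn']; ring
    have hp0 : 0 ≤ p := by linarith
    have hq0 : 0 ≤ q := by linarith
    have s1 := sqrt_add_sqrt_le hp0 hq0
    have s2 : √(2 * (p + q)) ≤ √(2 * (p + q + n)) := Real.sqrt_le_sqrt (by linarith)
    have s3 := mul_le_mul_of_nonneg_left (s1.trans s2) hB
    have s4 := mul_nonneg hB (add_nonneg hp0 hq0)
    rw [hpq]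
    rw [abs_le] at *
    constructor <;> linarith

lemma koop {t : ℝ} (ht : t ∈ params) (hξ : ξ ∈ cone) (hΨ : PerBdd Ψ M) (hB : 0 ≤ B)
    (h : NearConst Ψ (dir t ξ) c A B) :
    NearConst (koop t Ψ) ξ c (A + B) (9 / 10 * B) := by
  intro a y₀ y₁ h0 h01 h1
  have hp := stretch_pos ht hξ
  have hb := (stretch_bounds ht hξ).1
  rw [line_koop ht hξ Ψ a h0 h01 h1]
  set Λ := stretch t ξ
  have := h.extend hΨ hB (a * (1 - dir t ξ)) (y₀ := a + Λ * y₀) (y₁ := a + Λ * y₁) (by gcongr)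
  have hl : a + Λ * y₁ - (a + Λ * y₀) = Λ * (y₁ - y₀) := by ring
  rw [hl] at this
  have hs : √(2 * (Λ * (y₁ - y₀))) ≤ 9 / 10 * Λ * √(y₁ - y₀) := by
    rw [← Real.sqrt_sq (by positivity : 0 ≤ 9 / 10 * Λ), ← Real.sqrt_mul (by positivity)]
    apply Real.sqrt_le_sqrt
    have : 0 ≤ (y₁ - y₀) * Λ := mul_nonneg (by linarith) hp.le
    nlinarith
  have hs' := mul_le_mul_of_nonneg_left hs hB
  set L := line Ψ (dir t ξ) (a * (1 - dir t ξ)) (a + Λ * y₀) (a + Λ * y₁)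
  have e : Λ⁻¹ * L - c * (y₁ - y₀) = Λ⁻¹ * (L - c * (Λ * (y₁ - y₀))) := by field_simp
  rw [e, abs_mul, abs_of_pos (inv_pos.2 hp), inv_mul_le_iff₀ hp]
  linarith

lemma iterate {t : ℝ} (ht : t ∈ params) (hΨ : PerBdd Ψ M) (hB : 0 ≤ B) (n : ℕ) :
    ∀ {ξ}, ξ ∈ cone → NearConst Ψ ((dir t)^[n] ξ) c A B →
      NearConst ((_root_.koop t)^[n] Ψ) ξ c (A + 10 * B * (1 - (9 / 10) ^ n))
        ((9 / 10) ^ n * B) := by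
  induction n with
  | zero => intro ξ _ h; simpa using h
  | succ n ih =>
    intro ξ hξ h
    have := (ih (dir_mem ht hξ) h).koop ht hξ (hΨ.iterate t n) (by positivity)
    rw [Function.iterate_succ_apply']
    convert this using 1 <;> ring

lemma mono (h : NearConst Ψ ξ c A B) {A' B' : ℝ} (hA : A ≤ A') (hB : B ≤ B') :
    NearConst Ψ ξ c A' B' := by
  intro a y₀ y₁ h0 h01 h1
  refine (h a y₀ y₁ h0 h01 h1).trans ?_
  have : 0 ≤ y₁ - y₀ := by linarith
  gcongr

end NearConst

namespace TransHolder

variable {Ψ : ℝ → ℝ → ℝ} {M ξ c A B κ P : ℝ}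

lemma cell (hΨ : PerBdd Ψ M) (hS : NearConst Ψ ξ c A B) (h : TransHolder Ψ ξ κ P) (hA : 0 ≤ A)
    (hP : 0 ≤ P) (hB : 0 ≤ B) (a : ℝ) {d y₀ y₁ : ℝ} (hd0 : 0 ≤ d) (hd1 : d ≤ 1) (k : ℤ)
    (h0 : k ≤ y₀) (h01 : y₀ ≤ y₁) (h1 : y₁ ≤ k + 1) :
    |line Ψ ξ a y₀ y₁ - line Ψ ξ (a + (ξ + κ) * d) (y₀ - d) (y₁ - d)|
      ≤ (P + 2 * (A + B)) * √d := by
  have hd : d ≤ √d := Real.le_sqrt_of_sq_le (by nlinarith)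
  have matched : ∀ {u v : ℝ}, k + d ≤ u → u ≤ v → v ≤ k + 1 →
      |line Ψ ξ a u v - line Ψ ξ (a + (ξ + κ) * d) (u - d) (v - d)| ≤ P * √d := by
    intro u v hu huv hv
    have := h (a + ξ * k) d (u - k) (v - k) hd0 (by linarith) (by linarith) (by linarith)
    rw [← hΨ.line_shift'] at this
    convert this using 3
    rw [hΨ.line_shift' _ _ _ _ k]
    congr 1 <;> ring
  have unmatched : ∀ {u v : ℝ}, k ≤ u → u ≤ v → v ≤ k + 1 → v ≤ k + d →
      |line Ψ ξ a u v - line Ψ ξ (a + (ξ + κ) * d) (u - d) (v - d)| ≤ 2 * (A + B) * √d := by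
    intro u v hu huv hv hvd
    have e1 := hS.cell hΨ a k hu huv hv
    have e2 := hS.cell hΨ (a + (ξ + κ) * d) (k - 1) (y₀ := u - d) (y₁ := v - d)
      (by push_cast; linarith) (by linarith) (by push_cast; linarith)
    rw [sub_sub_sub_cancel_right] at e2
    have l1 : √(v - u) ≤ √d := Real.sqrt_le_sqrt (by linarith)
    have l2 := mul_le_mul_of_nonneg_left l1 hB
    have l3 := mul_le_mul_of_nonneg_left (show v - u ≤ √d by linarith) hA
    rw [abs_le] at *
    constructor <;> linarith
  have hs := Real.sqrt_nonneg d
  rcases le_total (k + d) y₀ with hc | hc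
  · refine (matched hc h01 h1).trans ?_
    gcongr; linarith
  rcases le_total y₁ (k + d) with hc' | hc'
  · refine (unmatched h0 h01 h1 hc').trans ?_
    gcongr; linarith
  · have e1 := matched le_rfl hc' h1
    have e2 := unmatched h0 hc (hc'.trans h1) le_rfl
    rw [← hΨ.line_add ξ a _ (k + d) _, ← hΨ.line_add ξ (a + _) _ (k + d - d) _]
    rw [abs_le] at *
    constructor <;> linarith

lemma cells (hΨ : PerBdd Ψ M) (hS : NearConst Ψ ξ c A B) (h : TransHolder Ψ ξ κ P) (hA : 0 ≤ A)
    (hP : 0 ≤ P) (hB : 0 ≤ B) (a : ℝ) {d : ℝ} (hd0 : 0 ≤ d) (hd1 : d ≤ 1) (k : ℤ) (n : ℕ) :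
    ∀ {y₀ y₁ : ℝ}, k ≤ y₀ → y₀ ≤ y₁ → y₁ ≤ k + n →
    |line Ψ ξ a y₀ y₁ - line Ψ ξ (a + (ξ + κ) * d) (y₀ - d) (y₁ - d)|
      ≤ n * ((P + 2 * (A + B)) * √d) := by
  have hX : 0 ≤ (P + 2 * (A + B)) * √d := by positivity
  have one := fun {y₀ y₁ : ℝ} (j : ℤ) => h.cell hΨ hS hA hP hB a (y₀ := y₀) (y₁ := y₁) hd0 hd1 j
  induction n with
  | zero =>
    intro y₀ y₁ h0 h01 h1
    have : y₀ = y₁ := le_antisymm h01 (by push_cast at h1; linarith)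
    simp [this, line]
  | succ n ih =>
    intro y₀ y₁ h0 h01 h1
    push_cast at h1 ⊢
    have cast : ((k + n : ℤ) : ℝ) = k + n := by push_cast; rfl
    rcases le_total y₁ (k + n) with hc | hc
    · linarith [ih h0 h01 hc]
    rcases le_total (k + n : ℝ) y₀ with hc' | hc'
    · have := one (k + n) (by rw [cast]; exact hc') h01 (by rw [cast]; linarith)
      have : 0 ≤ n * ((P + 2 * (A + B)) * √d) := by positivity
      linarith
    · have e1 := ih h0 hc' le_rfl
      have e2 := one (k + n) cast.le (y₁ := y₁) hc (by rw [cast]; linarith)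
      rw [← hΨ.line_add ξ a _ (k + n) _, ← hΨ.line_add ξ (a + _) _ (k + n - d) _]
      rw [abs_le] at *
      constructor <;> linarith

lemma koop {t : ℝ} (ht : t ∈ params) (hκ : IsStable t κ) (hξ : ξ ∈ cone) (hΨ : PerBdd Ψ M)
    (hS : NearConst Ψ (dir t ξ) c A B) (h : TransHolder Ψ (dir t ξ) κ P) (hA : 0 ≤ A)
    (hP : 0 ≤ P) (hB : 0 ≤ B) :
    TransHolder (koop t Ψ) ξ κ (96 / 100 * P + 2 * (A + B)) := by
  intro a d y₀ y₁ hd0 hd h01 h1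
  have hp := stretch_pos ht hξ
  obtain ⟨hb, hb'⟩ := stretch_bounds ht hξ
  have hμ0 := hκ.eig_nonneg
  have hμ1 := hκ.eig_le
  rw [line_koop ht hξ Ψ a (hd0.trans hd) h01 h1,
    line_koop ht hξ Ψ _ (sub_nonneg.2 hd) (by linarith) (by linarith)]
  set μ := 2 - t - κ with hμ
  have hint : (a + (ξ + κ) * d) * (1 - dir t ξ)
      = a * (1 - dir t ξ) + (dir t ξ + κ) * (μ * d) := by
    have : (ξ + κ) * (1 - dir t ξ) = (dir t ξ + κ) * μ := by
      have hp' := hp.ne'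
      unfold dir
      field_simp
      unfold stretch
      rw [hμ]
      linear_combination (2 + ξ - t) * hκ.eq
    linear_combination d * this
  have hend : ∀ y, a + (ξ + κ) * d + stretch t ξ * (y - d) = a + stretch t ξ * y - μ * d := by
    intro y; unfold stretch; rw [hμ]; ring
  rw [hint, hend, hend, ← mul_sub, abs_mul, abs_of_pos (inv_pos.2 hp), inv_mul_le_iff₀ hp]
  set Λ := stretch t ξ
  have hd1 : d ≤ 1 := by linarith
  have hfl := Int.floor_le (a + Λ * y₀)
  have hfl' := Int.lt_floor_add_one (a + Λ * y₀)
  have hlen : Λ * (y₁ - y₀) ≤ 3 * 1 := by gcongr; linarith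
  refine (h.cells hΨ hS hA hP hB (a * (1 - dir t ξ)) (d := μ * d) (by positivity) (by nlinarith)
    ⌊a + Λ * y₀⌋ 4 hfl (by gcongr) (by push_cast; linarith)).trans ?_
  have hsq : √(μ * d) ≤ 62 / 100 * √d := by
    rw [Real.sqrt_mul hμ0]
    gcongr
    rw [Real.sqrt_le_left (by norm_num)]
    linarith
  have : 4 * (62 / 100) * (P + 2 * (A + B)) ≤ Λ * (96 / 100 * P + 2 * (A + B)) := by
    nlinarith
  calc ((4 : ℕ) : ℝ) * ((P + 2 * (A + B)) * √(μ * d))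
      ≤ 4 * ((P + 2 * (A + B)) * (62 / 100 * √d)) := by push_cast; gcongr
    _ = (4 * (62 / 100) * (P + 2 * (A + B))) * √d := by ring
    _ ≤ (Λ * (96 / 100 * P + 2 * (A + B))) * √d := by gcongr
    _ = _ := by ring

lemma mono (h : TransHolder Ψ ξ κ P) {P' : ℝ} (hP : P ≤ P') : TransHolder Ψ ξ κ P' := by
  intro a d y₀ y₁ h0 h01 h1 h2
  refine (h a d y₀ y₁ h0 h01 h1 h2).trans ?_
  gcongr

lemma iterate {t : ℝ} (ht : t ∈ params) (hκ : IsStable t κ) (hΨ : PerBdd Ψ M) (hA : 0 ≤ A)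
    (hP : 0 ≤ P) (hB : 0 ≤ B) (n : ℕ) :
    ∀ {ξ}, ξ ∈ cone → NearConst Ψ ((dir t)^[n] ξ) c A B → TransHolder Ψ ((dir t)^[n] ξ) κ P →
      TransHolder ((_root_.koop t)^[n] Ψ) ξ κ ((96 / 100) ^ n * P + 50 * (A + 11 * B)) := by
  induction n with
  | zero => intro ξ _ _ h; exact h.mono (by simp; positivity)
  | succ n ih =>
    intro ξ hξ hS h
    have hξ' := dir_mem ht hξ
    have hn : (9 / 10 : ℝ) ^ n ≤ 1 := pow_le_one₀ (by norm_num) (by norm_num)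
    have hS' := (hS.iterate ht hΨ hB n hξ').mono (A' := A + 10 * B) (B' := B)
      (by nlinarith [mul_nonneg hB (pow_nonneg (by norm_num : (0 : ℝ) ≤ 9 / 10) n)])
      (by nlinarith)
    have := (ih hξ' hS h).koop ht hκ hξ (hΨ.iterate t n) hS' (by positivity) (by positivity) hB
    rw [Function.iterate_succ_apply']
    refine this.mono ?_
    rw [pow_succ]
    linarith

end TransHolder

/-- The expansion factor of `n` iterations in the direction `(ξ, 1)`. -/
def stretchIter (t : ℝ) : ℕ → ℝ → ℝ
  | 0, _ => 1
  | n + 1, ξ => stretch t ξ * stretchIter t n (dir t ξ)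

lemma stretchIter_bounds {t : ℝ} (ht : t ∈ params) (n : ℕ) :
    ∀ {ξ}, ξ ∈ cone → 1 ≤ stretchIter t n ξ ∧ stretchIter t n ξ ≤ 3 ^ n := by
  induction n with
  | zero => intro ξ _; simp [stretchIter]
  | succ n ih =>
    intro ξ hξ
    obtain ⟨h1, h2⟩ := ih (dir_mem ht hξ)
    obtain ⟨h3, h4⟩ := stretch_bounds ht hξ
    constructor
    · rw [stretchIter]; nlinarith
    · rw [stretchIter, pow_succ']; gcongr

/-- The `n`-th image of the segment of direction `ξ`, intercept `a` and heights in `[y₀, y₁]`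
contains, modulo `ℤ²`, a segment crossing the whole strip, whose intercept is at distance at most
`h` to the left of `1`. -/
def Reaches (t : ℝ) (n : ℕ) (ξ a y₀ y₁ h : ℝ) : Prop :=
  ∀ (Ψ : ℝ → ℝ → ℝ) (M : ℝ), PerBdd Ψ M → ∃ z₀ z₁ h' : ℝ, y₀ ≤ z₀ ∧ z₁ ≤ y₁ ∧
    z₁ - z₀ = (stretchIter t n ξ)⁻¹ ∧ 0 ≤ h' ∧ h' ≤ h ∧
    line ((koop t)^[n] Ψ) ξ a z₀ z₁ =
      (stretchIter t n ξ)⁻¹ * line Ψ ((dir t)^[n] ξ) (1 - h') 0 1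

namespace Reaches

variable {t ξ a y₀ y₁ h : ℝ} {n : ℕ}

lemma mono (H : Reaches t n ξ a y₀ y₁ h) {h' : ℝ} (hh : h ≤ h') : Reaches t n ξ a y₀ y₁ h' := by
  intro Ψ M hΨ
  obtain ⟨z₀, z₁, k, e1, e2, e3, e4, e5, e6⟩ := H Ψ M hΨ
  exact ⟨z₀, z₁, k, e1, e2, e3, e4, e5.trans hh, e6⟩

lemma extend (H : Reaches t n ξ a y₀ y₁ h) {u₀ u₁ : ℝ} (h0 : u₀ ≤ y₀) (h1 : y₁ ≤ u₁) :
    Reaches t n ξ a u₀ u₁ h := by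
  intro Ψ M hΨ
  obtain ⟨z₀, z₁, k, e1, e2, e3, e4, e5, e6⟩ := H Ψ M hΨ
  exact ⟨z₀, z₁, k, h0.trans e1, e2.trans h1, e3, e4, e5, e6⟩

lemma add_int (H : Reaches t n ξ a y₀ y₁ h) (k : ℤ) : Reaches t n ξ (a + k) y₀ y₁ h := by
  intro Ψ M hΨ
  obtain ⟨z₀, z₁, k, e1, e2, e3, e4, e5, e6⟩ := H Ψ M hΨ
  exact ⟨z₀, z₁, k, e1, e2, e3, e4, e5, by rw [(hΨ.iterate t n).line_add_int, e6]⟩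

lemma step (ht : t ∈ params) (hξ : ξ ∈ cone) {w₀ w₁ : ℝ} (k : ℤ)
    (H : Reaches t n (dir t ξ) (a * (1 - dir t ξ) + dir t ξ * k) w₀ w₁ h)
    (h0 : 0 ≤ y₀) (h1 : y₁ ≤ 1) (hw0 : a + stretch t ξ * y₀ ≤ w₀ + k)
    (hw1 : w₁ + k ≤ a + stretch t ξ * y₁) : Reaches t (n + 1) ξ a y₀ y₁ h := by
  intro Ψ M hΨ
  obtain ⟨v₀, v₁, h', e1, e2, e3, e4, e5, e6⟩ := H Ψ M hΨ
  have hp := stretch_pos ht hξ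
  have hq : 0 < stretchIter t n (dir t ξ) := by
    linarith [(stretchIter_bounds ht n (dir_mem ht hξ)).1]
  set Λ := stretch t ξ with hΛ
  have hv : v₀ ≤ v₁ := by linarith [inv_pos.2 hq]
  have c0 : y₀ ≤ (v₀ + k - a) / Λ := by rw [le_div_iff₀ hp]; linarith
  have c1 : (v₁ + k - a) / Λ ≤ y₁ := by rw [div_le_iff₀ hp]; linarith
  have c01 : (v₀ + k - a) / Λ ≤ (v₁ + k - a) / Λ := by gcongr
  refine ⟨(v₀ + k - a) / Λ, (v₁ + k - a) / Λ, h', c0, c1, ?_, e4, e5, ?_⟩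
  · rw [stretchIter, mul_inv, ← e3, ← hΛ]
    field_simp
    ring
  · rw [Function.iterate_succ_apply', Function.iterate_succ_apply,
      line_koop ht hξ _ _ (h0.trans c0) c01 (c1.trans h1), ← hΛ, stretchIter, mul_inv,
      mul_assoc, ← e6, (hΨ.iterate t n).line_shift]
    congr 2 <;> field_simp <;> ring

lemma crossing (ht : t ∈ params) (n : ℕ) : ∀ {ξ h : ℝ}, ξ ∈ cone → 0 ≤ h → h ≤ 1 →
    Reaches t n ξ (1 - h) 0 1 ((2 / 5) ^ n * h) := by
  induction n with
  | zero =>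
    intro ξ h _ h0 _ Ψ M _
    exact ⟨0, 1, h, by simp, by simp, by simp [stretchIter], h0, by simp, by simp [stretchIter]⟩
  | succ n ih =>
    intro ξ h hξ h0 h1
    have hd := dir_mem ht hξ
    have hb := (stretch_bounds ht hξ).1
    obtain ⟨d1, d2⟩ := id hd
    have hh : (1 - dir t ξ) * h ≤ 2 / 5 * h := by gcongr; linarith
    have hh0 : 0 ≤ (1 - dir t ξ) * h := mul_nonneg (by linarith) h0
    have := ih hd hh0 (by linarith)
    refine step ht hξ (w₀ := 0) (w₁ := 1) 1 ?_ le_rfl le_rfl (by push_cast; linarith)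
      (by push_cast; linarith)
    have e : (1 - h) * (1 - dir t ξ) + dir t ξ * (1 : ℤ) = 1 - (1 - dir t ξ) * h := by
      push_cast; ring
    rw [e]
    refine this.mono ?_
    rw [pow_succ, mul_assoc]
    gcongr

lemma crossing' (ht : t ∈ params) (n : ℕ) (hξ : ξ ∈ cone) (a : ℝ) :
    Reaches t n ξ a 0 1 ((2 / 5) ^ n) := by
  have := (crossing ht n hξ (h := 1 - Int.fract a) (by linarith [Int.fract_lt_one a])
    (by linarith [Int.fract_nonneg a])).add_int ⌊a⌋
  rw [sub_sub_cancel, Int.fract_add_floor] at this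
  refine this.mono (mul_le_of_le_one_right (by positivity) ?_)
  linarith [Int.fract_nonneg a]

lemma of_long (ht : t ∈ params) (r q : ℕ) : ∀ {ξ a y₀ y₁ : ℝ}, ξ ∈ cone → 0 ≤ y₀ → y₁ ≤ 1 →
    1 ≤ (5 / 4) ^ q * (y₁ - y₀) → Reaches t (q + r) ξ a y₀ y₁ ((2 / 5) ^ r) := by
  induction q with
  | zero =>
    intro ξ a y₀ y₁ hξ h0 h1 hl
    rw [pow_zero, one_mul] at hl
    rw [zero_add]
    exact (crossing' ht r hξ a).extend (by linarith) (by linarith)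
  | succ q ih =>
    intro ξ a y₀ y₁ hξ h0 h1 hl
    have hd := dir_mem ht hξ
    have hb := (stretch_bounds ht hξ).1
    have hp := stretch_pos ht hξ
    rw [pow_succ] at hl
    set Λ := stretch t ξ with hΛ
    set u₀ := a + Λ * y₀ with hu₀
    set u₁ := a + Λ * y₁ with hu₁
    have hq : (0 : ℝ) < (5 / 4) ^ q := by positivity
    have hl0 : 0 < y₁ - y₀ := by
      by_contra! hneg
      nlinarith [mul_nonneg hq.le (sub_nonneg.2 (sub_nonpos.1 hneg))]
    have hlen : 5 / 4 * (2 * (y₁ - y₀)) ≤ u₁ - u₀ := by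
      rw [hu₀, hu₁]; nlinarith
    have key : ∀ w, 5 / 4 * (y₁ - y₀) ≤ w → 1 ≤ (5 / 4 : ℝ) ^ q * w := by
      intro w hw
      refine hl.trans ?_
      rw [mul_assoc]
      gcongr
    have f0 := Int.floor_le u₀
    have f0' := Int.lt_floor_add_one u₀
    rw [Nat.add_right_comm]
    rcases le_total u₁ (⌊u₀⌋ + 1) with hc | hc
    · exact step ht hξ ⌊u₀⌋ (ih (y₀ := u₀ - ⌊u₀⌋) (y₁ := u₁ - ⌊u₀⌋) hd (by linarith) (by linarith)
        (key _ (by linarith))) h0 h1 (by linarith) (by linarith)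
    rcases le_total (⌊u₀⌋ + 2 : ℝ) u₁ with hc' | hc'
    · refine step ht hξ (w₀ := 0) (w₁ := 1) (⌊u₀⌋ + 1)
        ((crossing' ht (q + r) hd _).mono ?_) h0 h1 (by push_cast; linarith)
        (by push_cast; linarith)
      exact pow_le_pow_of_le_one (by norm_num) (by norm_num) (by omega)
    rcases le_total (5 / 4 * (y₁ - y₀)) (⌊u₀⌋ + 1 - u₀) with hc'' | hc''
    · exact step ht hξ ⌊u₀⌋ (ih (y₀ := u₀ - ⌊u₀⌋) (y₁ := 1) hd (by linarith) le_rfl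
        (key _ (by linarith))) h0 h1 (by linarith) (by linarith)
    · exact step ht hξ (⌊u₀⌋ + 1) (ih (y₀ := 0) (y₁ := u₁ - (⌊u₀⌋ + 1)) hd le_rfl (by linarith)
        (key _ (by linarith))) h0 h1 (by push_cast; linarith) (by push_cast; linarith)

end Reaches

/-- Averages of `Ψ` over segments of direction `ξ` in the strip `0 ≤ y ≤ 1` have oscillation
controlled by `E`, with a weight `β` penalising short segments. -/
def OscBound (Ψ : ℝ → ℝ → ℝ) (ξ β E : ℝ) : Prop :=
  ∀ a y₀ y₁ a' y₀' y₁', 0 ≤ y₀ → y₀ < y₁ → y₁ ≤ 1 → 0 ≤ y₀' → y₀' < y₁' → y₁' ≤ 1 →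
    |line Ψ ξ a y₀ y₁ / (y₁ - y₀) - line Ψ ξ a' y₀' y₁' / (y₁' - y₀')|
      ≤ E * ((1 + β / √(y₁ - y₀)) + (1 + β / √(y₁' - y₀')))

lemma OscBound.exists_nearConst {Ψ : ℝ → ℝ → ℝ} {ξ β E : ℝ} (h : OscBound Ψ ξ β E) :
    ∃ c, NearConst Ψ ξ c E (β * E) := by
  let seg : Set (ℝ × ℝ × ℝ) := {w | 0 ≤ w.2.1 ∧ w.2.1 < w.2.2 ∧ w.2.2 ≤ 1}
  let j : ℝ × ℝ × ℝ → ℝ := fun w => line Ψ ξ w.1 w.2.1 w.2.2 / (w.2.2 - w.2.1)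
  let v : ℝ × ℝ × ℝ → ℝ := fun w => E * (1 + β / √(w.2.2 - w.2.1))
  have hne : seg.Nonempty := ⟨(0, 0, 1), by simp [seg]⟩
  obtain ⟨c, hc1, hc2⟩ := exists_between_of_forall_le (s := (fun w => j w - v w) '' seg)
    (t := (fun w => j w + v w) '' seg) (hne.image _) (hne.image _) (by
      rintro _ ⟨w, ⟨w1, w2, w3⟩, rfl⟩ _ ⟨w', ⟨w1', w2', w3'⟩, rfl⟩
      have := (abs_le.1 (h w.1 w.2.1 w.2.2 w'.1 w'.2.1 w'.2.2 w1 w2 w3 w1' w2' w3')).2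
      simp only [j, v]
      linarith)
  refine ⟨c, fun a y₀ y₁ h0 h01 h1 => ?_⟩
  rcases h01.eq_or_lt with rfl | h01
  · simp [line]
  have hw : (a, y₀, y₁) ∈ seg := ⟨h0, h01, h1⟩
  have e1 := hc1 (mem_image_of_mem _ hw)
  have e2 := hc2 (mem_image_of_mem _ hw)
  simp only [j, v] at e1 e2
  have hl : 0 < y₁ - y₀ := sub_pos.2 h01
  have hs : √(y₁ - y₀) * √(y₁ - y₀) = y₁ - y₀ := Real.mul_self_sqrt hl.le
  have hs0 : 0 < √(y₁ - y₀) := Real.sqrt_pos.2 hl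
  have hmul : (y₁ - y₀) * (E * (1 + β / √(y₁ - y₀))) = E * (y₁ - y₀) + β * E * √(y₁ - y₀) := by
    field_simp
    linear_combination (-E * β) * hs
  have hdiv : (y₁ - y₀) * (line Ψ ξ a y₀ y₁ / (y₁ - y₀)) = line Ψ ξ a y₀ y₁ := by field_simp
  have e1' := mul_le_mul_of_nonneg_left e1 hl.le
  have e2' := mul_le_mul_of_nonneg_left e2 hl.le
  rw [mul_sub, hmul, hdiv] at e1'
  rw [mul_add, hmul, hdiv] at e2'
  rw [abs_le]
  constructor <;> linarith

namespace NearConst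

variable {Ψ : ℝ → ℝ → ℝ} {M ξ c A B κ P : ℝ}

lemma abs_mean_sub_le (h : NearConst Ψ ξ c A B) (a : ℝ) {y₀ y₁ : ℝ} (h0 : 0 ≤ y₀) (h01 : y₀ < y₁)
    (h1 : y₁ ≤ 1) : |line Ψ ξ a y₀ y₁ / (y₁ - y₀) - c| ≤ A + B / √(y₁ - y₀) := by
  have hl : 0 < y₁ - y₀ := sub_pos.2 h01
  have hs : √(y₁ - y₀) * √(y₁ - y₀) = y₁ - y₀ := Real.mul_self_sqrt hl.le
  have hs0 : 0 < √(y₁ - y₀) := Real.sqrt_pos.2 hl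
  have e : line Ψ ξ a y₀ y₁ / (y₁ - y₀) - c = (line Ψ ξ a y₀ y₁ - c * (y₁ - y₀)) / (y₁ - y₀) := by
    field_simp
  rw [e, abs_div, abs_of_pos hl, div_le_iff₀ hl]
  refine (h a y₀ y₁ h0 h01.le h1).trans (le_of_eq ?_)
  field_simp
  linear_combination B * hs

lemma abs_crossing_sub_le {t h : ℝ} (ht : t ∈ params) (hκ : IsStable t κ) (hξ : ξ ∈ cone)
    (hΨ : PerBdd Ψ M) (hS : NearConst Ψ ξ c A B) (hT : TransHolder Ψ ξ κ P) (hA : 0 ≤ A)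
    (hB : 0 ≤ B) (hP : 0 ≤ P) (h0 : 0 ≤ h) (h1 : h ≤ 1) :
    |line Ψ ξ (1 - h) 0 1 - line Ψ ξ 1 0 1| ≤ (P + 2 * (A + B)) * √h := by
  have hκ1 : 1 ≤ κ := by
    have := hκ.eq
    have := mul_nonneg (show 0 ≤ 1 - t by linarith [ht.2]) hκ.pos.le
    nlinarith [hκ.pos]
  have hs : 1 ≤ ξ + κ := by linarith [hξ.1]
  have hs0 : 0 < ξ + κ := by linarith
  set d := h / (ξ + κ) with hd
  have hd0 : 0 ≤ d := by positivity
  have hdh : d ≤ h := div_le_self h0 hs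
  have hmul : (ξ + κ) * d = h := by rw [hd]; field_simp
  have e1 := hT (1 - h) d d 1 hd0 le_rfl (hdh.trans h1) le_rfl
  rw [hmul, sub_add_cancel, sub_self] at e1
  have e2 := hS (1 - h) 0 d le_rfl hd0 (hdh.trans h1)
  have e3 := hS 1 (1 - d) 1 (by linarith) (by linarith) le_rfl
  rw [sub_zero] at e2
  rw [sub_sub_cancel] at e3
  have hsd : √d ≤ √h := Real.sqrt_le_sqrt hdh
  have hhs : h ≤ √h := Real.le_sqrt_of_sq_le (by nlinarith)
  have l1 := mul_le_mul_of_nonneg_left hsd hP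
  have l2 := mul_le_mul_of_nonneg_left hsd hB
  have l3 := mul_le_mul_of_nonneg_left (hdh.trans hhs) hA
  rw [← hΨ.line_add ξ (1 - h) 0 d 1, ← hΨ.line_add ξ 1 0 (1 - d) 1]
  rw [abs_le] at *
  constructor <;> linarith

lemma abs_mean_sub_le_of_reaches {t β E δ : ℝ} {R : ℕ} (ht : t ∈ params) (hκ : IsStable t κ)
    (hξ : ξ ∈ cone) (hΨ : PerBdd Ψ M) (hE : 0 ≤ E) (hβ : 0 ≤ β) (hβ1 : β ≤ 1)
    (hS : NearConst Ψ ((dir t)^[R] ξ) c E (β * E))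
    (hT : TransHolder Ψ ((dir t)^[R] ξ) κ (400 * E)) {a y₀ y₁ h : ℝ} (h0 : 0 ≤ y₀)
    (h1 : y₁ ≤ 1) (hδ0 : 0 < δ) (hδ : δ ≤ y₁ - y₀) (hR : Reaches t R ξ a y₀ y₁ h) (hh1 : h ≤ 1)
    (hη : 404 * √h ≤ δ / 4) (hβδ : 13 * β ≤ δ * (3 ^ R)⁻¹ / 4) :
    |line ((_root_.koop t)^[R] Ψ) ξ a y₀ y₁ / (y₁ - y₀) -
      (c + (stretchIter t R ξ)⁻¹ * (line Ψ ((dir t)^[R] ξ) 1 0 1 - c))|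
      ≤ E * (1 - (3 ^ R)⁻¹ / 2) := by
  obtain ⟨z₀, z₁, h', hz0, hz1, hz, hh0, hh', hline⟩ := hR Ψ M hΨ
  have hξ' := dir_iterate_mem ht hξ R
  have hS' := (hS.iterate ht hΨ (by positivity) R hξ).mono (A' := E + 10 * β * E) (B' := β * E)
    (by
      have : 0 ≤ β * E * (9 / 10) ^ R := by positivity
      nlinarith)
    (mul_le_of_le_one_left (by positivity) (pow_le_one₀ (by norm_num) (by norm_num)))
  have hX := abs_crossing_sub_le ht hκ hξ' hΨ hS hT hE (by positivity) (by positivity) hh0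
    (hh'.trans hh1)
  have hst := stretchIter_bounds ht R hξ
  set p := (stretchIter t R ξ)⁻¹ with hp
  have hp0 : 0 < p := inv_pos.2 (by linarith)
  have hp1 : (3 ^ R)⁻¹ ≤ p := inv_anti₀ (by linarith) hst.2
  set X := line Ψ ((dir t)^[R] ξ) (1 - h') 0 1
  set e := line Ψ ((dir t)^[R] ξ) 1 0 1 - c with he
  have he1 : |e| ≤ E + β * E := by simpa using hS 1 0 1 le_rfl zero_le_one le_rfl
  have hX' : |X - c - e| ≤ E * (δ / 4) := by
    have : X - c - e = X - line Ψ ((dir t)^[R] ξ) 1 0 1 := by rw [he]; ring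
    rw [this]
    refine hX.trans ?_
    have hss : √h' ≤ √h := Real.sqrt_le_sqrt hh'
    calc (400 * E + 2 * (E + β * E)) * √h' ≤ (400 * E + 2 * (E + 1 * E)) * √h := by gcongr
      _ = E * (404 * √h) := by ring
      _ ≤ _ := by gcongr
  have hl : 0 < y₁ - y₀ := by linarith
  set ℓ := y₁ - y₀ with hℓ
  have hℓ1 : ℓ ≤ 1 := by linarith
  have sq1 : ∀ x ≤ (1 : ℝ), √x ≤ 1 := fun x hx => by rwa [Real.sqrt_le_one]
  have e1 := hS' a y₀ z₀ h0 hz0 (by linarith)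
  have e2 := hS' a z₁ y₁ (by linarith) hz1 h1
  have r1 := mul_le_mul_of_nonneg_left (sq1 (z₀ - y₀) (by linarith)) (mul_nonneg hβ hE)
  have r2 := mul_le_mul_of_nonneg_left (sq1 (y₁ - z₁) (by linarith)) (mul_nonneg hβ hE)
  have hJ : line ((_root_.koop t)^[R] Ψ) ξ a y₀ y₁
      = line ((_root_.koop t)^[R] Ψ) ξ a y₀ z₀ + p * X + line ((_root_.koop t)^[R] Ψ) ξ a z₁ y₁ := by
    rw [← hline, (hΨ.iterate t R).line_add, (hΨ.iterate t R).line_add]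
  set J := line ((_root_.koop t)^[R] Ψ) ξ a y₀ y₁
  have hpe : |p * (1 - ℓ) * e| ≤ p * (1 - ℓ) * (E + β * E) := by
    have : 0 ≤ p * (1 - ℓ) := mul_nonneg hp0.le (by linarith)
    rw [abs_mul, abs_of_nonneg this]
    gcongr
  have hpX : |p * (X - c - e)| ≤ p * (E * (δ / 4)) := by
    rw [abs_mul, abs_of_pos hp0]
    gcongr
  have main : |J - ℓ * (c + p * e)| ≤ (E + 10 * β * E) * (ℓ - p) + 2 * (β * E)
      + p * (E * (δ / 4)) + p * (1 - ℓ) * (E + β * E) := by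
    have hsum : (E + 10 * β * E) * (ℓ - p)
        = (E + 10 * β * E) * (z₀ - y₀) + (E + 10 * β * E) * (y₁ - z₁) := by
      rw [← hz]; ring
    have hdec : J - ℓ * (c + p * e) = (line ((_root_.koop t)^[R] Ψ) ξ a y₀ z₀ - c * (z₀ - y₀))
        + (line ((_root_.koop t)^[R] Ψ) ξ a z₁ y₁ - c * (y₁ - z₁)) + p * (X - c - e)
        + p * (1 - ℓ) * e := by
      rw [hJ, hℓ]
      linear_combination (-c) * hz
    rw [hdec, hsum]
    rw [abs_le] at *
    constructor <;> linarith
  have ediv : J / ℓ - (c + p * e) = (J - ℓ * (c + p * e)) / ℓ := by field_simp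
  rw [ediv, abs_div, abs_of_pos hl, div_le_iff₀ hl]
  refine main.trans ?_
  have hpl : p ≤ 1 := inv_le_one_of_one_le₀ hst.1
  have b1 : β * (ℓ - p) ≤ β := mul_le_of_le_one_right hβ (by linarith)
  have b2 : p * (1 - ℓ) * β ≤ β :=
    mul_le_of_le_one_left hβ (mul_le_one₀ hpl (by linarith) (by linarith))
  have b3 : δ * (3 ^ R)⁻¹ ≤ ℓ * p := by gcongr
  have b4 : p * δ ≤ p * ℓ := by gcongr
  have b5 : ℓ * (3 ^ R)⁻¹ ≤ ℓ * p := by gcongr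
  have : (1 + 10 * β) * (ℓ - p) + 2 * β + p * (δ / 4) + p * (1 - ℓ) * (1 + β)
      ≤ (1 - (3 ^ R)⁻¹ / 2) * ℓ := by
    nlinarith
  calc _ = E * ((1 + 10 * β) * (ℓ - p) + 2 * β + p * (δ / 4) + p * (1 - ℓ) * (1 + β)) := by ring
    _ ≤ E * ((1 - (3 ^ R)⁻¹ / 2) * ℓ) := by gcongr
    _ = _ := by ring

end NearConst

/-- A fixed number of iterations contracts the oscillation, uniformly in the parameter. -/
lemma exists_contraction : ∃ (R : ℕ) (β : ℝ), 0 < R ∧ 0 < β ∧ β ≤ 1 / 10 ∧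
    ∀ {t κ : ℝ}, t ∈ params → IsStable t κ → ∀ {Ψ : ℝ → ℝ → ℝ} {M E : ℝ}, PerBdd Ψ M → 0 ≤ E →
      (∀ ξ ∈ cone, OscBound Ψ ξ β E ∧ TransHolder Ψ ξ κ (400 * E)) →
      ∀ ξ ∈ cone, OscBound ((koop t)^[R] Ψ) ξ β ((1 - 5 * β) * E) ∧
        TransHolder ((koop t)^[R] Ψ) ξ κ (400 * ((1 - 5 * β) * E)) := by
  obtain ⟨r, hr⟩ : ∃ r : ℕ, ((2 : ℝ) / 5) ^ r < (1 / 6400 / 4 / 404) ^ 2 :=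
    exists_pow_lt_of_lt_one (by positivity) (by norm_num)
  set R := 50 + r with hR
  have h3 : (0 : ℝ) < (3 ^ R)⁻¹ := by positivity
  have h3' : ((3 : ℝ) ^ R)⁻¹ ≤ 1 := inv_le_one_of_one_le₀ (one_le_pow₀ (by norm_num))
  have hsqrt : 404 * √((2 / 5) ^ r) ≤ 1 / 6400 / 4 := by
    have : √((2 / 5) ^ r) ≤ 1 / 6400 / 4 / 404 := Real.sqrt_le_iff.2 ⟨by norm_num, hr.le⟩
    linarith
  have h9 : (9 / 10 : ℝ) ^ R ≤ 1 / 2 :=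
    (pow_le_pow_of_le_one (by norm_num) (by norm_num) (show 50 ≤ R by omega)).trans (by norm_num)
  have h96 : (96 / 100 : ℝ) ^ R ≤ 1 / 4 :=
    (pow_le_pow_of_le_one (by norm_num) (by norm_num) (show 50 ≤ R by omega)).trans (by norm_num)
  set β : ℝ := 1 / 6400 * (3 ^ R)⁻¹ / 52 with hβ
  have hβ0 : 0 < β := by positivity
  have hβ1 : β ≤ 1 / 10 := by rw [hβ]; linarith
  have hβ5 : 5 * β ≤ (3 ^ R)⁻¹ / 2 := by rw [hβ]; linarith
  refine ⟨R, β, by omega, hβ0, hβ1, ?_⟩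
  intro t κ ht hκ Ψ M E hΨ hE H ξ hξ
  have hξ' := dir_iterate_mem ht hξ R
  obtain ⟨hO, hT⟩ := H _ hξ'
  obtain ⟨c, hS⟩ := hO.exists_nearConst
  constructor
  · intro a y₀ y₁ a' y₀' y₁' h0 h01 h1 h0' h01' h1'
    set V := 1 / √(y₁ - y₀) with hV
    set V' := 1 / √(y₁' - y₀') with hV'
    have hV0 : 0 < V := one_div_pos.2 (Real.sqrt_pos.2 (sub_pos.2 h01))
    have hV0' : 0 < V' := one_div_pos.2 (Real.sqrt_pos.2 (sub_pos.2 h01'))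
    rw [show β / √(y₁ - y₀) = β * V by rw [hV]; ring,
      show β / √(y₁' - y₀') = β * V' by rw [hV']; ring]
    rcases le_total 80 (V + V') with hc | hc
    · have hS' := (hS.iterate ht hΨ (by positivity) R hξ).mono (A' := E + 10 * β * E)
        (B' := 1 / 2 * (β * E))
        (by
          have : 0 ≤ β * E * (9 / 10) ^ R := by positivity
          nlinarith)
        (by gcongr)
      have e1 := hS'.abs_mean_sub_le a h0 h01 h1
      have e2 := hS'.abs_mean_sub_le a' h0' h01' h1'
      rw [show 1 / 2 * (β * E) / √(y₁ - y₀) = 1 / 2 * (β * E) * V by rw [hV]; ring] at e1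
      rw [show 1 / 2 * (β * E) / √(y₁' - y₀') = 1 / 2 * (β * E) * V' by rw [hV']; ring] at e2
      have key : 2 + 20 * β + 1 / 2 * β * (V + V')
          ≤ (1 - 5 * β) * (2 + β * (V + V')) := by
        have : 80 * β ≤ β * (V + V') := by nlinarith
        have : 0 ≤ β * (V + V') * (1 / 10 - β) := mul_nonneg (by positivity) (by linarith)
        have : β * (V + V') * β ≤ β * (V + V') * (1 / 80) := by
          gcongr
          rw [hβ]; linarith
        linarith
      have key' := mul_le_mul_of_nonneg_left key hE
      rw [abs_le] at *
      constructor <;> linarith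
    · have long : ∀ {u v : ℝ}, u < v → 1 / √(v - u) ≤ 80 → 1 / 6400 ≤ v - u := by
        intro u v huv hle
        have hs : 0 < √(v - u) := Real.sqrt_pos.2 (sub_pos.2 huv)
        rw [div_le_iff₀ hs] at hle
        have := Real.mul_self_sqrt (sub_pos.2 huv).le
        nlinarith
      have l1 := long h01 (by rw [← hV]; linarith)
      have l2 := long h01' (by rw [← hV']; linarith)
      have grow : ∀ {x : ℝ}, 1 / 6400 ≤ x → 1 ≤ (5 / 4 : ℝ) ^ 50 * x := by
        intro x hx
        have : (6400 : ℝ) ≤ (5 / 4) ^ 50 := by norm_num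
        nlinarith
      have hrr : ((2 : ℝ) / 5) ^ r ≤ 1 := pow_le_one₀ (by norm_num) (by norm_num)
      have e1 := hS.abs_mean_sub_le_of_reaches ht hκ hξ hΨ hE hβ0.le (by linarith) hT h0 h1
        (by norm_num) l1 (Reaches.of_long ht r 50 (a := a) hξ h0 h1 (grow l1)) hrr hsqrt
        (by rw [hβ]; linarith)
      have e2 := hS.abs_mean_sub_le_of_reaches ht hκ hξ hΨ hE hβ0.le (by linarith) hT h0' h1'
        (by norm_num) l2 (Reaches.of_long ht r 50 (a := a') hξ h0' h1' (grow l2)) hrr hsqrt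
        (by rw [hβ]; linarith)
      have key : E * (1 - (3 ^ R)⁻¹ / 2) * 2
          ≤ (1 - 5 * β) * E * (1 + β * V + (1 + β * V')) := by
        calc E * (1 - (3 ^ R)⁻¹ / 2) * 2 ≤ E * (1 - 5 * β) * 2 := by gcongr
          _ = (1 - 5 * β) * E * 2 := by ring
          _ ≤ _ := by
            have : 0 ≤ 1 - 5 * β := by linarith
            have : 0 < β * V := by positivity
            have : 0 < β * V' := by positivity
            gcongr
            linarith
      rw [abs_le] at *
      constructor <;> linarith
  · refine (hT.iterate ht hκ hΨ hE (by positivity) (by positivity) R hξ hS).mono ?_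
    have k1 : (96 / 100) ^ R * (400 * E) ≤ 1 / 4 * (400 * E) := by gcongr
    have k2 : β * E ≤ 1 / 6400 * E := by gcongr; rw [hβ]; linarith
    nlinarith

/-- Exponential decay of correlations, uniform in the parameter, for averages over diagonal
segments. -/
lemma exists_decay : ∃ C θ : ℝ, 0 ≤ C ∧ 0 < θ ∧ θ < 1 ∧
    ∀ {t κ : ℝ}, t ∈ params → IsStable t κ → ∀ {Ψ : ℝ → ℝ → ℝ} {M : ℝ}, PerBdd Ψ M →
      (∀ ξ ∈ cone, TransHolder Ψ ξ κ M) → ∀ (n : ℕ) (a a' : ℝ),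
        |line ((koop t)^[n] Ψ) 1 a 0 1 - line ((koop t)^[n] Ψ) 1 a' 0 1| ≤ C * M * θ ^ n := by
  obtain ⟨R, β, hR, hβ0, hβ1, H⟩ := exists_contraction
  set ρ := 1 - 5 * β with hρ
  have hρ0 : 0 < ρ := by linarith
  have hρ1 : ρ < 1 := by linarith
  set θ := ρ ^ ((R : ℝ)⁻¹) with hθ
  have hθ0 : 0 < θ := Real.rpow_pos_of_pos hρ0 _
  have hθ1 : θ < 1 := Real.rpow_lt_one hρ0.le hρ1 (by positivity)
  have hθR : θ ^ R = ρ := Real.rpow_inv_natCast_pow hρ0.le hR.ne'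
  refine ⟨5 / ρ, θ, by positivity, hθ0, hθ1, ?_⟩
  intro t κ ht hκ Ψ M hΨ hT n a a'
  have hM := hΨ.nonneg
  have blocks : ∀ k : ℕ, ∀ ξ ∈ cone, OscBound ((koop t)^[R * k] Ψ) ξ β (ρ ^ k * M) ∧
      TransHolder ((koop t)^[R * k] Ψ) ξ κ (400 * (ρ ^ k * M)) := by
    intro k
    induction k with
    | zero =>
      intro ξ hξ
      refine ⟨?_, (hT ξ hξ).mono (by simp; linarith)⟩
      intro a y₀ y₁ a' y₀' y₁' h0 h01 h1 h0' h01' h1'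
      have bd : ∀ {a u v : ℝ}, u < v → |line Ψ ξ a u v / (v - u)| ≤ M := by
        intro a u v huv
        rw [abs_div, abs_of_pos (sub_pos.2 huv), div_le_iff₀ (sub_pos.2 huv)]
        exact hΨ.abs_line_le ξ a huv.le
      have e1 := bd (a := a) h01
      have e2 := bd (a := a') h01'
      have p1 : 0 ≤ M * (β / √(y₁ - y₀)) := by positivity
      have p2 : 0 ≤ M * (β / √(y₁' - y₀')) := by positivity
      simp only [mul_zero, Function.iterate_zero, id_eq, pow_zero, one_mul]
      rw [abs_le] at *
      constructor <;> linarith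
    | succ k ih =>
      have := H ht hκ (hΨ.iterate t (R * k)) (by positivity) ih
      rw [← Function.iterate_add_apply] at this
      rw [show R * (k + 1) = R + R * k by ring, pow_succ', mul_assoc]
      exact this
  set k := n / R
  set i := n % R
  have hn : n = i + R * k := (Nat.mod_add_div n R).symm
  have hone : (1 : ℝ) ∈ cone := by constructor <;> norm_num
  obtain ⟨c, hS⟩ := (blocks k _ (dir_iterate_mem ht hone i)).1.exists_nearConst
  have hE : 0 ≤ ρ ^ k * M := by positivity
  set E := ρ ^ k * M with hEdef
  have hS' := hS.iterate ht (hΨ.iterate t (R * k)) (by positivity) i hone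
  rw [← Function.iterate_add_apply, ← hn] at hS'
  have hS' := hS'.mono (A' := E + 10 * β * E) (B' := β * E)
    (by
      have : 0 ≤ β * E * (9 / 10) ^ i := by positivity
      nlinarith)
    (mul_le_of_le_one_left (by positivity) (pow_le_one₀ (by norm_num) (by norm_num)))
  have e1 := hS' a 0 1 le_rfl zero_le_one le_rfl
  have e2 := hS' a' 0 1 le_rfl zero_le_one le_rfl
  simp only [sub_zero, Real.sqrt_one, mul_one] at e1 e2
  have hpow : ρ ^ k ≤ θ ^ n / ρ := by
    rw [le_div_iff₀ hρ0, hn, pow_add, pow_mul, hθR, mul_comm]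
    gcongr
    rw [← hθR]
    exact pow_le_pow_of_le_one hθ0.le hθ1.le (Nat.mod_lt n hR).le
  have fin : 5 * E ≤ 5 / ρ * M * θ ^ n := by
    calc 5 * E ≤ 5 * (θ ^ n / ρ * M) := by rw [hEdef]; gcongr
      _ = _ := by ring
  have hβE : β * E ≤ 1 / 10 * E := by gcongr
  rw [abs_le] at *
  constructor <;> linarith

/-- The `ℤ²`-periodic extension of the restriction of `φ` to the unit square. -/
def lift (φ : ℝ × ℝ → ℝ) : ℝ → ℝ → ℝ := fun x y => φ (Int.fract x, Int.fract y)

lemma fract_mem_unitSq (x y : ℝ) : (Int.fract x, Int.fract y) ∈ unitSq :=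
  ⟨⟨Int.fract_nonneg x, (Int.fract_lt_one x).le⟩, Int.fract_nonneg y, (Int.fract_lt_one y).le⟩

lemma koop_lift (t : ℝ) (φ : ℝ × ℝ → ℝ) : koop t (lift φ) = lift (φ ∘ catF t) := by
  have h : ∀ x z : ℝ, Int.fract (Int.fract x + z) = Int.fract (x + z) := fun x z => by
    rw [← Int.fract_add_intCast (Int.fract x + z) ⌊x⌋, add_right_comm, Int.fract_add_floor]
  ext x y
  simp [koop, lift, catF, h]

lemma koop_iterate_lift (t : ℝ) (φ : ℝ × ℝ → ℝ) (n : ℕ) :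
    (koop t)^[n] (lift φ) = lift (φ ∘ (catF t)^[n]) := by
  induction n generalizing φ with
  | zero => rfl
  | succ n ih => rw [Function.iterate_succ_apply, koop_lift, ih, Function.comp_assoc,
      ← Function.iterate_succ']

lemma isCompact_unitSq : IsCompact unitSq := isCompact_Icc.prod isCompact_Icc

lemma exists_perBdd_lift {φ : ℝ × ℝ → ℝ} (hφ : Continuous φ) : ∃ B, PerBdd (lift φ) B := by
  obtain ⟨B, hB⟩ := isCompact_unitSq.exists_bound_of_continuousOn hφ.continuousOn
  refine ⟨B, ?_, fun x y => hB _ (fract_mem_unitSq x y), fun x y => ?_, fun x y => ?_⟩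
  · exact hφ.measurable.comp (measurable_fst.fract.prodMk measurable_snd.fract)
  · simp [lift]
  · simp [lift]

lemma intervalIntegrable_fract (u v : ℝ) : IntervalIntegrable (Int.fract : ℝ → ℝ) volume u v := by
  refine (intervalIntegrable_const (c := (1 : ℝ))).mono_fun
    measurable_fract.aestronglyMeasurable (Eventually.of_forall fun y => ?_)
  simpa [abs_of_nonneg (Int.fract_nonneg y)] using (Int.fract_lt_one y).le

/-- The measure of the set where a segment is separated from its translate by an integer. -/
lemma integral_floor_sub_floor_le {ξ h u v : ℝ} (hξ : 0 < ξ) (h0 : 0 ≤ h)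
    (huv1 : v - u ≤ 1) (a : ℝ) :
    IntervalIntegrable (fun y => (⌊a + h + ξ * y⌋ - ⌊a + ξ * y⌋ : ℝ)) volume u v ∧
    ∫ y in u..v, (⌊a + h + ξ * y⌋ - ⌊a + ξ * y⌋ : ℝ) ≤ h + ξ⁻¹ * h := by
  have hi : ∀ b, IntervalIntegrable (fun y => Int.fract (b + ξ * y)) volume u v := fun b => by
    have := (intervalIntegrable_fract (b + ξ * u) (b + ξ * v)).comp_add_left b
    simp only [add_sub_cancel_left] at this
    have := this.comp_mul_left (c := ξ)
    simpa [hξ.ne'] using this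
  have heq : ∀ y, (⌊a + h + ξ * y⌋ - ⌊a + ξ * y⌋ : ℝ)
      = h - (Int.fract (a + h + ξ * y) - Int.fract (a + ξ * y)) := fun y => by
    unfold Int.fract; ring
  simp only [heq]
  have hi' := (hi (a + h)).sub (hi a)
  refine ⟨intervalIntegrable_const.sub hi', ?_⟩
  rw [intervalIntegral.integral_sub intervalIntegrable_const hi',
    intervalIntegral.integral_sub (hi _) (hi _), intervalIntegral.integral_const, smul_eq_mul,
    intervalIntegral.integral_comp_add_mul _ hξ.ne', intervalIntegral.integral_comp_add_mul _ hξ.ne',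
    ← smul_sub, smul_eq_mul, intervalIntegral.integral_interval_sub_interval_comm
    (intervalIntegrable_fract _ _) (intervalIntegrable_fract _ _) (intervalIntegrable_fract _ _)]
  have e1 : ∫ x in (a + h + ξ * u)..(a + ξ * u), Int.fract x ≥ -h := by
    rw [intervalIntegral.integral_symm]
    have := intervalIntegral.integral_mono_on (a := a + ξ * u) (b := a + h + ξ * u) (by linarith)
      (intervalIntegrable_fract _ _) (intervalIntegrable_const (c := (1 : ℝ)))
      fun x _ => (Int.fract_lt_one x).le
    rw [intervalIntegral.integral_const] at this
    simp only [smul_eq_mul] at this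
    linarith
  have e2 : ∫ x in (a + h + ξ * v)..(a + ξ * v), Int.fract x ≤ 0 := by
    rw [intervalIntegral.integral_symm]
    have := intervalIntegral.integral_nonneg (μ := volume) (a := a + ξ * v) (b := a + h + ξ * v)
      (by linarith) fun x _ => Int.fract_nonneg x
    linarith
  have e3 : ξ⁻¹ * -h ≤ ξ⁻¹ * ((∫ x in (a + h + ξ * u)..(a + ξ * u), Int.fract x) -
      ∫ x in (a + h + ξ * v)..(a + ξ * v), Int.fract x) := by
    gcongr
    linarith
  have e4 : (v - u) * h ≤ h := mul_le_of_le_one_left h0 huv1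
  linarith

lemma exists_transHolder_lift {φ : ℝ × ℝ → ℝ} (hφ : ContDiff ℝ 1 φ) :
    ∃ M, PerBdd (lift φ) M ∧
      ∀ κ, 0 ≤ κ → κ ≤ 2 → ∀ ξ ∈ cone, TransHolder (lift φ) ξ κ M := by
  obtain ⟨B, hB⟩ := exists_perBdd_lift hφ.continuous
  obtain ⟨L, hL⟩ := hφ.contDiffOn.exists_lipschitzOnWith one_ne_zero
    ((convex_Icc (0 : ℝ) 1).prod (convex_Icc (0 : ℝ) 1)) isCompact_unitSq
  have hB0 := hB.nonneg
  refine ⟨2 * L + 12 * B, ⟨hB.meas, fun x y => (hB.bdd x y).trans ?_, hB.perx, hB.pery⟩, ?_⟩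
  · have := L.coe_nonneg
    linarith
  intro κ hκ0 hκ2 ξ hξ a d y₀ y₁ hd hdy h01 h1
  have hξ0 : 0 < ξ := by linarith [hξ.1]
  have hshift : line (lift φ) ξ (a + (ξ + κ) * d) (y₀ - d) (y₁ - d)
      = ∫ y in y₀..y₁, lift φ (a + κ * d + ξ * y) (y - d) := by
    unfold line
    rw [← intervalIntegral.integral_comp_sub_right]
    congr 1; ext y; congr 1; ring
  have hd1 : d ≤ 1 := by linarith
  have hκd : 0 ≤ κ * d := by positivity
  obtain ⟨hfi, hfl⟩ := integral_floor_sub_floor_le (u := y₀) (v := y₁) hξ0 hκd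
    (by linarith) a
  have i1 := hB.intervalIntegrable (f := fun y => a + ξ * y) (g := fun y => y)
    (by fun_prop) (by fun_prop) y₀ y₁
  have i2 := hB.intervalIntegrable (f := fun y => a + κ * d + ξ * y) (g := fun y => y - d)
    (by fun_prop) (by fun_prop) y₀ y₁
  have hbound : ∀ y ∈ Ioo y₀ y₁,
      ‖lift φ (a + ξ * y) y - lift φ (a + κ * d + ξ * y) (y - d)‖
        ≤ 2 * L * d + 2 * B * (⌊a + κ * d + ξ * y⌋ - ⌊a + ξ * y⌋) := by
    intro y hy
    have fy : Int.fract y = y := Int.fract_eq_self.2 ⟨by linarith [hy.1], by linarith [hy.2]⟩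
    have fy' : Int.fract (y - d) = y - d :=
      Int.fract_eq_self.2 ⟨by linarith [hy.1], by linarith [hy.2]⟩
    have hle : ⌊a + ξ * y⌋ ≤ ⌊a + κ * d + ξ * y⌋ := Int.floor_le_floor (by linarith)
    rcases hle.eq_or_lt with he | hlt
    · rw [he, sub_self, mul_zero, add_zero]
      have := hL.dist_le_mul _ (fract_mem_unitSq (a + ξ * y) y) _
        (fract_mem_unitSq (a + κ * d + ξ * y) (y - d))
      rw [← dist_eq_norm]
      refine this.trans ?_
      have hdist : dist (Int.fract (a + ξ * y), Int.fract y)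
          (Int.fract (a + κ * d + ξ * y), Int.fract (y - d)) ≤ 2 * d := by
        rw [Prod.dist_eq, fy, fy', Int.fract, Int.fract, he, Real.dist_eq, Real.dist_eq]
        refine max_le ?_ ?_
        · rw [show a + ξ * y - ⌊a + κ * d + ξ * y⌋ - (a + κ * d + ξ * y - ⌊a + κ * d + ξ * y⌋)
            = -(κ * d) by ring, abs_neg, abs_of_nonneg hκd]
          gcongr
        · rw [sub_sub_cancel, abs_of_nonneg hd]
          linarith
      calc _ ≤ L * (2 * d) := by gcongr
        _ = _ := by ring
    · have h1' : (1 : ℝ) ≤ ⌊a + κ * d + ξ * y⌋ - ⌊a + ξ * y⌋ := by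
        have : ⌊a + ξ * y⌋ + 1 ≤ ⌊a + κ * d + ξ * y⌋ := hlt
        have : ((⌊a + ξ * y⌋ + 1 : ℤ) : ℝ) ≤ ⌊a + κ * d + ξ * y⌋ := by exact_mod_cast this
        push_cast at this
        linarith
      have b1 := hB.bdd (a + ξ * y) y
      have b2 := hB.bdd (a + κ * d + ξ * y) (y - d)
      have : 0 ≤ 2 * L * d := by positivity
      have := mul_le_mul_of_nonneg_left h1' (show 0 ≤ 2 * B by positivity)
      rw [Real.norm_eq_abs]
      rw [abs_le] at *
      constructor <;> linarith
  have hdd : d ≤ √d := Real.le_sqrt_of_sq_le (by nlinarith)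
  have hξi : ξ⁻¹ ≤ 5 / 3 := by
    rw [inv_le_comm₀ hξ0 (by norm_num)]; linarith [hξ.1]
  have hfl' : κ * d + ξ⁻¹ * (κ * d) ≤ 16 / 3 * d := by
    calc κ * d + ξ⁻¹ * (κ * d) ≤ 2 * d + 5 / 3 * (2 * d) := by gcongr
      _ = _ := by ring
  rw [hshift, line, ← intervalIntegral.integral_sub i1 i2, ← Real.norm_eq_abs]
  have hint : IntervalIntegrable (fun y => 2 * L * d + 2 * B *
      (⌊a + κ * d + ξ * y⌋ - ⌊a + ξ * y⌋ : ℝ)) volume y₀ y₁ :=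
    intervalIntegrable_const.add (hfi.const_mul _)
  refine (intervalIntegral.norm_integral_le_of_norm_le h01 ?_ hint).trans ?_
  · filter_upwards [compl_mem_ae_iff.2 (measure_singleton y₁)] with y hy hy'
    exact hbound y ⟨hy'.1, lt_of_le_of_ne hy'.2 hy⟩
  rw [intervalIntegral.integral_add intervalIntegrable_const (hfi.const_mul _),
    intervalIntegral.integral_const, intervalIntegral.integral_const_mul, smul_eq_mul]
  calc (y₁ - y₀) * (2 * L * d) + 2 * B * ∫ y in y₀..y₁, (⌊a + κ * d + ξ * y⌋ - ⌊a + ξ * y⌋ : ℝ)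
      ≤ 1 * (2 * L * d) + 2 * B * (16 / 3 * d) := by
        gcongr
        · linarith
        · exact hfl.trans hfl'
    _ ≤ (2 * L + 12 * B) * d := by
        have : 0 ≤ B * d := by positivity
        linarith
    _ ≤ _ := by gcongr

/-- The mean of a periodic function. -/
def mean (Ψ : ℝ → ℝ → ℝ) : ℝ := ∫ y in (0 : ℝ)..1, ∫ x in (0 : ℝ)..1, Ψ x y

namespace PerBdd

variable {Ψ : ℝ → ℝ → ℝ} {B : ℝ}

lemma setIntegral_unitOpenSq (h : PerBdd Ψ B) : ∫ p in unitOpenSq, Ψ p.1 p.2 = mean Ψ := by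
  have hi : IntegrableOn (fun p : ℝ × ℝ => Ψ p.1 p.2) (Ioo 0 1 ×ˢ Ioo 0 1) (volume.prod volume) := by
    refine Measure.integrableOn_of_bounded (M := B) ?_ h.meas.aestronglyMeasurable
      (Eventually.of_forall fun p => h.bdd _ _)
    simp [Measure.prod_prod]
  rw [unitOpenSq, Measure.volume_eq_prod, setIntegral_prod _ hi, mean]
  rw [integral_integral_swap (by rwa [IntegrableOn, ← Measure.prod_restrict] at hi)]
  simp only [intervalIntegral.integral_of_le zero_le_one, integral_Ioc_eq_integral_Ioo]

lemma mean_eq_setIntegral_lift {φ : ℝ × ℝ → ℝ} (h : PerBdd (lift φ) B) :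
    ∫ p in unitOpenSq, φ p = mean (lift φ) := by
  rw [← h.setIntegral_unitOpenSq]
  refine setIntegral_congr_fun (measurableSet_Ioo.prod measurableSet_Ioo) fun p hp => ?_
  have h1 : Int.fract p.1 = p.1 := Int.fract_eq_self.2 ⟨hp.1.1.le, hp.1.2⟩
  have h2 : Int.fract p.2 = p.2 := Int.fract_eq_self.2 ⟨hp.2.1.le, hp.2.2⟩
  simp [lift, h1, h2]

lemma measurable_line (h : PerBdd Ψ B) (ξ u v : ℝ) : Measurable fun a => line Ψ ξ a u v := by
  have hm : Measurable fun p : ℝ × ℝ => Ψ (p.1 + ξ * p.2) p.2 :=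
    h.meas.comp (f := fun p : ℝ × ℝ => (p.1 + ξ * p.2, p.2)) (by fun_prop)
  unfold line intervalIntegral
  exact (hm.stronglyMeasurable.integral_prod_right' (ν := volume.restrict (Ioc u v))).measurable.sub
    (hm.stronglyMeasurable.integral_prod_right' (ν := volume.restrict (Ioc v u))).measurable

lemma abs_line_unit_le (h : PerBdd Ψ B) (ξ a : ℝ) : |line Ψ ξ a 0 1| ≤ B := by
  simpa using h.abs_line_le ξ a zero_le_one

lemma line_intervalIntegrable (h : PerBdd Ψ B) (ξ u v : ℝ) {f : ℝ → ℝ} (hf : Measurable f) :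
    IntervalIntegrable (fun r => line Ψ ξ (f r) 0 1) volume u v := by
  refine (intervalIntegrable_const (c := B)).mono_fun
    ((h.measurable_line ξ 0 1).comp hf).aestronglyMeasurable (Eventually.of_forall fun y => ?_)
  simpa [abs_of_nonneg h.nonneg] using h.abs_line_unit_le ξ (f y)

lemma line_periodic (h : PerBdd Ψ B) (ξ u v : ℝ) :
    Function.Periodic (fun a => line Ψ ξ a u v) 1 := fun a => by
  simpa using h.line_add_int ξ a u v 1

lemma mean_eq_integral_line (h : PerBdd Ψ B) : mean Ψ = ∫ a in (0 : ℝ)..1, line Ψ 1 a 0 1 := by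
  unfold line
  rw [intervalIntegral_intervalIntegral_swap]
  · unfold mean
    congr 1; ext y
    have hp : Function.Periodic (fun x => Ψ x y) 1 := fun x => h.perx x y
    have := hp.intervalIntegral_add_eq 0 (1 * y)
    rw [zero_add] at this
    rw [this, intervalIntegral.integral_comp_add_right (fun x => Ψ x y)]
    congr 1 <;> ring
  · refine Measure.integrableOn_of_bounded (M := B) ?_ (Measurable.aestronglyMeasurable ?_)
      (Eventually.of_forall fun p => h.bdd _ _)
    · rw [Measure.volume_eq_prod, Measure.prod_prod]
      simp
    · exact h.meas.comp (f := fun p : ℝ × ℝ => (p.1 + 1 * p.2, p.2)) (by fun_prop)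

lemma mean_koop (h : PerBdd Ψ B) {t : ℝ} (ht : t ∈ params) :
    mean (_root_.koop t Ψ) = mean Ψ
      + t * ((1 - t)⁻¹ * ∫ r in (0 : ℝ)..1, (line Ψ 1 r 0 1 - line Ψ 1 (t * r) 0 1)) := by
  have ht1 : 0 < 1 - t := by linarith [ht.2]
  set G : ℝ → ℝ := fun a => line Ψ 1 a 0 1 with hG
  have hGp : Function.Periodic G 1 := h.line_periodic 1 0 1
  have hGi : ∀ u v, IntervalIntegrable G volume u v :=
    fun u v => h.line_intervalIntegrable 1 u v measurable_id
  have e1 : mean (_root_.koop t Ψ) = ∫ y in (0 : ℝ)..1, G (-((1 - t) * y)) := by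
    unfold mean
    have inner : ∀ y ∈ Ioo (0 : ℝ) 1, ∫ x in (0 : ℝ)..1, _root_.koop t Ψ x y
        = ∫ x in (0 : ℝ)..1, Ψ (x - (1 - t) * y) x := by
      intro y hy
      have fy : Int.fract y = y := Int.fract_eq_self.2 ⟨hy.1.le, hy.2⟩
      have hp : Function.Periodic (fun x => Ψ (x - (1 - t) * y) x) 1 := fun x => by
        simp only
        rw [h.pery, ← h.perx (x - _)]
        congr 1; ring
      have := hp.intervalIntegral_add_eq 0 ((2 - t) * y)
      rw [zero_add] at this
      rw [this]
      have e := intervalIntegral.integral_comp_add_right (a := 0) (b := 1)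
        (fun x => Ψ (x - (1 - t) * y) x) ((2 - t) * y)
      rw [zero_add, add_comm 1] at e
      rw [← e]
      congr 1; ext x
      rw [_root_.koop, fy]
      congr 1; ring
    rw [intervalIntegral.integral_congr_Ioo_of_le zero_le_one inner]
    congr 1; ext y
    simp only [hG, line]
    congr 1; ext x
    congr 1; ring
  have e2 : ∫ y in (0 : ℝ)..1, G (-((1 - t) * y)) = (1 - t)⁻¹ * ∫ r in t..1, G r := by
    have := intervalIntegral.integral_comp_mul_left (a := 0) (b := 1) G (c := -(1 - t))
      (by linarith)
    simp only [neg_mul] at this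
    rw [this]
    have h2 := intervalIntegral.integral_comp_add_right (a := -(1 - t)) (b := 0) G 1
    have h3 : (fun x => G (x + 1)) = G := funext hGp
    rw [show (∫ x in -(1 - t)..0, G (x + 1)) = ∫ x in -(1 - t)..0, G x from
      congrArg (fun g : ℝ → ℝ => ∫ x in -(1 - t)..0, g x) h3] at h2
    rw [intervalIntegral.integral_symm, mul_zero, neg_zero, mul_one, h2, smul_eq_mul, inv_neg]
    rw [show -(1 - t) + 1 = t by ring, zero_add]
    ring
  have e3 : ∫ r in (0 : ℝ)..t, G r = t * ∫ r in (0 : ℝ)..1, G (t * r) := by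
    have := intervalIntegral.mul_integral_comp_mul_left (a := 0) (b := 1) (f := G) (c := t)
    rw [this]; simp
  have e4 : (∫ r in (0 : ℝ)..t, G r) + ∫ r in t..1, G r = mean Ψ := by
    rw [h.mean_eq_integral_line]
    exact intervalIntegral.integral_add_adjacent_intervals (hGi _ _) (hGi _ _)
  have e5 : ∫ r in (0 : ℝ)..1, (line Ψ 1 r 0 1 - line Ψ 1 (t * r) 0 1)
      = mean Ψ - ∫ r in (0 : ℝ)..1, G (t * r) := by
    rw [intervalIntegral.integral_sub (hGi _ _)
      (h.line_intervalIntegrable 1 _ _ (by fun_prop)), h.mean_eq_integral_line]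
  rw [e1, e2, e5]
  field_simp
  linear_combination e4 - e3

end PerBdd

/-- The increments of the mean along the iterates of the Koopman operator, divided by `t`. -/
def incr (Ψ : ℝ → ℝ → ℝ) (t : ℝ) (n : ℕ) : ℝ :=
  (1 - t)⁻¹ * ∫ r in (0 : ℝ)..1,
    (line ((koop t)^[n] Ψ) 1 r 0 1 - line ((koop t)^[n] Ψ) 1 (t * r) 0 1)

lemma PerBdd.mean_koop_iterate {Ψ : ℝ → ℝ → ℝ} {B t : ℝ} (h : PerBdd Ψ B) (ht : t ∈ params)
    (n : ℕ) : mean ((_root_.koop t)^[n] Ψ) = mean Ψ + t * ∑ k ∈ Finset.range n, incr Ψ t k := by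
  induction n with
  | zero => simp
  | succ n ih =>
    rw [Function.iterate_succ_apply', (h.iterate t n).mean_koop ht, ih, Finset.sum_range_succ, incr]
    ring

/-- Uniform exponential decay of the oscillation of averages over diagonal segments. -/
def Decays (Ψ : ℝ → ℝ → ℝ) (C θ : ℝ) : Prop :=
  ∀ t ∈ params, ∀ (n : ℕ) (a a' : ℝ),
    |line ((koop t)^[n] Ψ) 1 a 0 1 - line ((koop t)^[n] Ψ) 1 a' 0 1| ≤ C * θ ^ n

lemma exists_decays_lift {φ : ℝ × ℝ → ℝ} (hφ : ContDiff ℝ 1 φ) :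
    ∃ C θ, 0 ≤ C ∧ 0 < θ ∧ θ < 1 ∧ Decays (lift φ) C θ := by
  obtain ⟨C, θ, hC, h0, h1, H⟩ := exists_decay
  obtain ⟨M, hM, hT⟩ := exists_transHolder_lift hφ
  refine ⟨C * M, θ, mul_nonneg hC hM.nonneg, h0, h1, fun t ht n a a' => ?_⟩
  obtain ⟨κ, hκ⟩ := exists_isStable ht
  exact H ht hκ hM (hT κ hκ.pos.le hκ.le_two) n a a'

lemma Decays.abs_incr_le {Ψ : ℝ → ℝ → ℝ} {C θ t : ℝ} (h : Decays Ψ C θ) (ht : t ∈ params) (n : ℕ) :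
    |incr Ψ t n| ≤ 2 * C * θ ^ n := by
  have ht1 : 0 < 1 - t := by linarith [ht.2]
  have hi := intervalIntegral.norm_integral_le_of_norm_le_const (a := 0) (b := 1) (C := C * θ ^ n)
    (f := fun r => line ((koop t)^[n] Ψ) 1 r 0 1 - line ((koop t)^[n] Ψ) 1 (t * r) 0 1)
    (fun r _ => h t ht n _ _)
  have hinv : (1 - t)⁻¹ ≤ 2 := by
    rw [inv_le_comm₀ ht1 (by norm_num)]; linarith [ht.2]
  rw [sub_zero, abs_one, mul_one, Real.norm_eq_abs] at hi
  rw [incr, abs_mul, abs_of_pos (inv_pos.2 ht1)]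
  calc _ ≤ 2 * (C * θ ^ n) := by gcongr
    _ = _ := by ring

lemma Irrational.ne_floor {x : ℝ} (h : Irrational x) : x ≠ ⌊x⌋ := fun he => h.ne_int _ he

lemma Irrational.natCast_mul_sub_intCast {y : ℝ} (h : Irrational y) {m : ℕ} (hm : 0 < m) (i : ℤ) :
    Irrational (m * y - i) := (h.natCast_mul hm.ne').sub_intCast i

/-- Orbits starting near the diagonal, at a point with irrational coordinates, avoid the
discontinuities of the unperturbed map. -/
lemma continuousAt_catF_iterate {y : ℝ} (hy : Irrational y) (r : ℝ) (n : ℕ) :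
    ContinuousAt (fun t => (catF t)^[n] (Int.fract (t * r + 1 * y), Int.fract y)) 0 ∧
    ∃ (m k : ℕ) (i j : ℤ), 0 < m ∧ 0 < k ∧
      (catF 0)^[n] (Int.fract (0 * r + 1 * y), Int.fract y) = (m * y - i, k * y - j) := by
  induction n with
  | zero =>
    refine ⟨ContinuousAt.prodMk (ContinuousAt.comp (g := Int.fract) (continuousAt_fract ?_)
      (by fun_prop)) continuousAt_const, 1, 1, ⌊y⌋, ⌊y⌋, one_pos, one_pos, ?_⟩
    · simpa using hy.ne_floor
    · rw [Function.iterate_zero_apply, zero_mul, zero_add, one_mul, Nat.cast_one, one_mul]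
      rfl
  | succ n ih =>
    obtain ⟨hc, m, k, i, j, hm, hk, he⟩ := ih
    simp only [Function.iterate_succ_apply']
    have h1 : (m * y - i) + (k * y - j) = ((m + k : ℕ) : ℝ) * y - ((i + j : ℤ) : ℝ) := by
      push_cast; ring
    have h2 : (m * y - i) + (2 - 0) * (k * y - j)
        = ((m + 2 * k : ℕ) : ℝ) * y - ((i + 2 * j : ℤ) : ℝ) := by push_cast; ring
    constructor
    · refine ContinuousAt.prodMk (ContinuousAt.comp (g := Int.fract) (continuousAt_fract ?_) ?_)
        (ContinuousAt.comp (g := Int.fract) (continuousAt_fract ?_) ?_)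
      · rw [he, h1]
        exact (hy.natCast_mul_sub_intCast (by omega) _).ne_floor
      · exact hc.fst.add hc.snd
      · rw [he, h2]
        exact (hy.natCast_mul_sub_intCast (by omega) _).ne_floor
      · exact hc.fst.add ((continuousAt_const.sub continuousAt_id).mul hc.snd)
    · refine ⟨m + k, m + 2 * k, i + j + ⌊((m + k : ℕ) : ℝ) * y - ((i + j : ℤ) : ℝ)⌋,
        i + 2 * j + ⌊((m + 2 * k : ℕ) : ℝ) * y - ((i + 2 * j : ℤ) : ℝ)⌋, by omega, by omega, ?_⟩
      rw [he, catF, h1, h2]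
      ext
      · simp only [Int.fract]; push_cast; ring
      · simp only [Int.fract]; push_cast; ring

lemma ae_irrational : ∀ᵐ y : ℝ, Irrational y := by
  have : (Set.range ((↑) : ℚ → ℝ)).Countable := countable_range _
  exact this.ae_notMem volume

lemma tendsto_integral_line_lift {φ : ℝ × ℝ → ℝ} (hφ : Continuous φ) (n : ℕ) :
    Tendsto (fun t => ∫ r in (0 : ℝ)..1, line ((koop t)^[n] (lift φ)) 1 (t * r) 0 1) (𝓝 0)
      (𝓝 (line ((koop 0)^[n] (lift φ)) 1 0 0 1)) := by
  obtain ⟨B, hB⟩ := exists_perBdd_lift hφ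
  have hconst : line ((koop 0)^[n] (lift φ)) 1 0 0 1
      = ∫ r in (0 : ℝ)..1, line ((koop 0)^[n] (lift φ)) 1 (0 * r) 0 1 := by simp
  rw [hconst]
  refine intervalIntegral.tendsto_integral_filter_of_dominated_convergence (fun _ => B)
    (Eventually.of_forall fun t => ?_) (Eventually.of_forall fun t => ?_)
    intervalIntegrable_const ?_
  · exact (((hB.iterate t n).measurable_line 1 0 1).comp
      (measurable_const_mul t)).aestronglyMeasurable
  · exact Eventually.of_forall fun r _ => (hB.iterate t n).abs_line_unit_le 1 _
  refine Eventually.of_forall fun r _ => ?_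
  unfold line
  refine intervalIntegral.tendsto_integral_filter_of_dominated_convergence (fun _ => B)
    (Eventually.of_forall fun t => ?_) (Eventually.of_forall fun t => ?_)
    intervalIntegrable_const ?_
  · exact ((hB.iterate t n).meas.comp (f := fun y : ℝ => (t * r + 1 * y, y))
      (by fun_prop)).aestronglyMeasurable
  · exact Eventually.of_forall fun y _ => (hB.iterate t n).bdd _ _
  filter_upwards [ae_irrational] with y hy _
  simp only [koop_iterate_lift]
  exact hφ.continuousAt.comp (continuousAt_catF_iterate hy r n).1

lemma integral_catF_iterate {φ : ℝ × ℝ → ℝ} (hφ : Continuous φ) (t : ℝ) (n : ℕ) :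
    ∫ p in unitOpenSq, φ ((catF t)^[n] p) = mean ((koop t)^[n] (lift φ)) := by
  obtain ⟨B, hB⟩ := exists_perBdd_lift hφ
  have h := hB.iterate t n
  rw [koop_iterate_lift] at h ⊢
  exact h.mean_eq_setIntegral_lift

lemma integral_diag_catF_iterate (φ : ℝ × ℝ → ℝ) (n : ℕ) :
    ∫ s in (0 : ℝ)..1, φ ((catF 0)^[n] (s, s)) = line ((koop 0)^[n] (lift φ)) 1 0 0 1 := by
  rw [koop_iterate_lift, line]
  refine intervalIntegral.integral_congr_Ioo_of_le zero_le_one fun s hs => ?_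
  have : Int.fract s = s := Int.fract_eq_self.2 ⟨hs.1.le, hs.2⟩
  simp [lift, this]

lemma zero_mem_params : (0 : ℝ) ∈ params := by constructor <;> norm_num

namespace Decays

variable {Ψ : ℝ → ℝ → ℝ} {B C θ t : ℝ}

lemma summable_incr (h : Decays Ψ C θ) (h0 : 0 ≤ θ) (h1 : θ < 1) (ht : t ∈ params) :
    Summable (incr Ψ t) :=
  Summable.of_norm_bounded ((summable_geometric_of_lt_one h0 h1).mul_left (2 * C))
    fun n => h.abs_incr_le ht n

lemma tendsto_mean (h : Decays Ψ C θ) (h0 : 0 ≤ θ) (h1 : θ < 1) (hΨ : PerBdd Ψ B)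
    (ht : t ∈ params) :
    Tendsto (fun n => mean ((koop t)^[n] Ψ)) atTop (𝓝 (mean Ψ + t * ∑' n, incr Ψ t n)) := by
  simp only [hΨ.mean_koop_iterate ht]
  exact ((h.summable_incr h0 h1 ht).hasSum.tendsto_sum_nat.const_mul t).const_add _

lemma abs_mean_sub_line_le (h : Decays Ψ C θ) (hΨ : PerBdd Ψ B) (n : ℕ) :
    |mean Ψ - line ((koop 0)^[n] Ψ) 1 0 0 1| ≤ C * θ ^ n := by
  have h0 := hΨ.mean_koop_iterate zero_mem_params n
  rw [zero_mul, add_zero, (hΨ.iterate 0 n).mean_eq_integral_line] at h0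
  have hi := intervalIntegral.norm_integral_le_of_norm_le_const (a := 0) (b := 1) (C := C * θ ^ n)
    (f := fun r => line ((koop 0)^[n] Ψ) 1 r 0 1 - line ((koop 0)^[n] Ψ) 1 0 0 1)
    (fun r _ => h 0 zero_mem_params n _ _)
  rw [intervalIntegral.integral_sub
    ((hΨ.iterate 0 n).line_intervalIntegrable 1 _ _ measurable_id') intervalIntegrable_const, h0]
    at hi
  simpa using hi

lemma tendsto_mean_zero (h : Decays Ψ C θ) (hΨ : PerBdd Ψ B) (n : ℕ) :
    Tendsto (fun t => mean ((koop t)^[n] Ψ)) (𝓝[>] 0) (𝓝 (mean Ψ)) := by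
  rw [tendsto_iff_norm_sub_tendsto_zero]
  have hz : Tendsto (fun t : ℝ => t * ∑ k ∈ Finset.range n, 2 * C * θ ^ k) (𝓝[>] 0) (𝓝 0) := by
    have : Tendsto (fun t : ℝ => t * ∑ k ∈ Finset.range n, 2 * C * θ ^ k) (𝓝 0)
      (𝓝 (0 * ∑ k ∈ Finset.range n, 2 * C * θ ^ k)) := tendsto_id.mul_const _
    rw [zero_mul] at this
    exact this.mono_left nhdsWithin_le_nhds
  refine squeeze_zero' (Eventually.of_forall fun _ => norm_nonneg _) ?_ hz
  filter_upwards [Ioc_mem_nhdsGT (show (0 : ℝ) < 1 / 100 by norm_num)] with t ht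
  have ht' : t ∈ params := Ioc_subset_Icc_self ht
  rw [hΨ.mean_koop_iterate ht', add_sub_cancel_left, norm_mul, Real.norm_of_nonneg ht.1.le]
  gcongr
  · exact ht.1.le
  · exact norm_sum_le_of_le _ fun k _ => h.abs_incr_le ht' k

end Decays

lemma tendsto_incr_lift {φ : ℝ × ℝ → ℝ} (hφ : Continuous φ) {C θ : ℝ} (h : Decays (lift φ) C θ)
    (n : ℕ) : Tendsto (fun t => incr (lift φ) t n) (𝓝[>] 0)
      (𝓝 (mean (lift φ) - line ((koop 0)^[n] (lift φ)) 1 0 0 1)) := by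
  obtain ⟨B, hB⟩ := exists_perBdd_lift hφ
  have hincr : ∀ t, incr (lift φ) t n = (1 - t)⁻¹ * (mean ((koop t)^[n] (lift φ)) -
      ∫ r in (0 : ℝ)..1, line ((koop t)^[n] (lift φ)) 1 (t * r) 0 1) := fun t => by
    rw [incr, intervalIntegral.integral_sub
      ((hB.iterate t n).line_intervalIntegrable 1 _ _ measurable_id')
      ((hB.iterate t n).line_intervalIntegrable 1 _ _ (measurable_const_mul t)),
      ← (hB.iterate t n).mean_eq_integral_line]
  simp only [hincr]
  have h1 : Tendsto (fun t : ℝ => (1 - t)⁻¹) (𝓝[>] 0) (𝓝 1) := by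
    have : ContinuousAt (fun t : ℝ => (1 - t)⁻¹) 0 :=
      (continuousAt_const.sub continuousAt_id).inv₀ (by simp)
    simpa using this.tendsto.mono_left nhdsWithin_le_nhds
  simpa using h1.mul ((h.tendsto_mean_zero hB n).sub
    ((tendsto_integral_line_lift hφ n).mono_left nhdsWithin_le_nhds))

/-- Averages of continuous observables converge along the iterates of `catF t`. -/
lemma exists_tendsto_integral_catF {t : ℝ} (ht : t ∈ params) {φ : ℝ × ℝ → ℝ} (hφ : Continuous φ) :
    ∃ l, Tendsto (fun n : ℕ => ∫ p in unitOpenSq, φ ((catF t)^[n] p)) atTop (𝓝 l) := by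
  refine cauchySeq_tendsto_of_complete (Metric.cauchySeq_iff'.2 fun ε hε => ?_)
  obtain ⟨ψ, hψ, hd, -⟩ := hφ.exists_contDiff_approx 1 (continuous_const (y := ε / 4))
    (fun _ => by positivity)
  obtain ⟨C, θ, -, h0, h1, hD⟩ := exists_decays_lift hψ
  obtain ⟨B, hB⟩ := exists_perBdd_lift hψ.continuous
  obtain ⟨B', hB'⟩ := exists_perBdd_lift hφ
  obtain ⟨N, hN⟩ := Metric.cauchySeq_iff'.1 (hD.tendsto_mean h0.le h1 hB ht).cauchySeq (ε / 4)
    (by positivity)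
  have near : ∀ n, dist (mean ((koop t)^[n] (lift ψ))) (mean ((koop t)^[n] (lift φ))) ≤ ε / 4 := by
    intro n
    have e := hB.iterate t n
    have e' := hB'.iterate t n
    rw [Real.dist_eq, e.mean_eq_integral_line, e'.mean_eq_integral_line,
      ← intervalIntegral.integral_sub (e.line_intervalIntegrable 1 _ _ measurable_id')
        (e'.line_intervalIntegrable 1 _ _ measurable_id')]
    have := intervalIntegral.norm_integral_le_of_norm_le_const (a := 0) (b := 1) (C := ε / 4)
      (f := fun r => line ((koop t)^[n] (lift ψ)) 1 r 0 1 - line ((koop t)^[n] (lift φ)) 1 r 0 1)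
      (fun r _ => by
        unfold line
        rw [← intervalIntegral.integral_sub (e.intervalIntegrable (by fun_prop) (by fun_prop) _ _)
          (e'.intervalIntegrable (by fun_prop) (by fun_prop) _ _)]
        have := intervalIntegral.norm_integral_le_of_norm_le_const (a := 0) (b := 1) (C := ε / 4)
          (f := fun y => (koop t)^[n] (lift ψ) (r + 1 * y) y - (koop t)^[n] (lift φ) (r + 1 * y) y)
          (fun y _ => by
            rw [koop_iterate_lift, koop_iterate_lift]
            exact (hd _).le)
        simpa using this)
    simpa using this
  refine ⟨N, fun n hn => ?_⟩
  rw [integral_catF_iterate hφ, integral_catF_iterate hφ]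
  have d1 := dist_triangle4 (mean ((koop t)^[n] (lift φ))) (mean ((koop t)^[n] (lift ψ)))
    (mean ((koop t)^[N] (lift ψ))) (mean ((koop t)^[N] (lift φ)))
  rw [dist_comm _ (mean ((koop t)^[n] (lift ψ)))] at d1
  have := near n
  have := near N
  have := hN n hn
  linarith

/-- linear response for the perturbed Arnold cat map, with explicit
linear-response formula. -/
theorem cat_linear_response :
    ∃ ε₀ ∈ Set.Ioc (0:ℝ) (1/8), ∃ μ : ℝ → (ℝ × ℝ → ℝ) → ℝ,
      (∀ t ∈ Set.Ioc (0:ℝ) ε₀, ∀ φ : ℝ × ℝ → ℝ, Continuous φ →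
        Tendsto (fun n : ℕ => ∫ x in unitOpenSq, φ ((catF t)^[n] x)) atTop (𝓝 (μ t φ))) ∧
      ∀ φ : ℝ × ℝ → ℝ, ContDiff ℝ 1 φ →
        Summable (fun k : ℕ =>
          |(∫ x in unitOpenSq, φ x) - ∫ s in (0:ℝ)..1, φ ((catF 0)^[k] (s, s))|) ∧
        Tendsto (fun t : ℝ => (μ t φ - ∫ x in unitOpenSq, φ x) / t) (𝓝[>] (0:ℝ))
          (𝓝 (∑' k : ℕ,
            ((∫ x in unitOpenSq, φ x) - ∫ s in (0:ℝ)..1, φ ((catF 0)^[k] (s, s))))) := by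
  have hlim : ∀ t ∈ Ioc (0 : ℝ) (1 / 100), ∀ φ : ℝ × ℝ → ℝ, Continuous φ →
      Tendsto (fun n : ℕ => ∫ x in unitOpenSq, φ ((catF t)^[n] x)) atTop
        (𝓝 (limUnder atTop fun n : ℕ => ∫ x in unitOpenSq, φ ((catF t)^[n] x))) :=
    fun t ht φ hφ =>
      tendsto_nhds_limUnder (exists_tendsto_integral_catF (Ioc_subset_Icc_self ht) hφ)
  refine ⟨1 / 100, ⟨by norm_num, by norm_num⟩,
    fun t φ => limUnder atTop fun n : ℕ => ∫ x in unitOpenSq, φ ((catF t)^[n] x), hlim, ?_⟩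
  intro φ hφ
  obtain ⟨C, θ, -, h0, h1, hD⟩ := exists_decays_lift hφ
  obtain ⟨B, hB⟩ := exists_perBdd_lift hφ.continuous
  have hgeom := summable_geometric_of_lt_one h0.le h1
  simp only [integral_diag_catF_iterate, hB.mean_eq_setIntegral_lift]
  refine ⟨Summable.of_nonneg_of_le (fun _ => abs_nonneg _) (hD.abs_mean_sub_line_le hB)
    (hgeom.mul_left C), ?_⟩
  have hparams := Ioc_mem_nhdsGT (show (0 : ℝ) < 1 / 100 by norm_num)
  refine (tendsto_tsum_of_dominated_convergence (hgeom.mul_left (2 * C))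
    (tendsto_incr_lift hφ.continuous hD) ?_).congr' ?_
  · filter_upwards [hparams] with t ht n
    exact hD.abs_incr_le (Ioc_subset_Icc_self ht) n
  · filter_upwards [hparams] with t ht
    have hl := hlim t ht φ hφ.continuous
    have hm := hD.tendsto_mean h0.le h1 hB (Ioc_subset_Icc_self ht)
    simp only [← integral_catF_iterate hφ.continuous] at hm
    rw [tendsto_nhds_unique hl hm, add_sub_cancel_left, mul_div_cancel_left₀ _ ht.1.ne']
end
end

section
/- For every continuous φ : [0,1]² → ℝ: lim_{t→0⁺} (1/t) ∫_M (φ∘F_t − φ) dm = ∫_M φ dm − ∫₀¹ φ(s,s) ds. -/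
open MeasureTheory Filter Topology Set

noncomputable section

/-- The extension of `φ` from `[0,1)²` to a function on `ℝ²` with period one in each variable. -/
def periodize (φ : ℝ × ℝ → ℝ) (p : ℝ × ℝ) : ℝ := φ (Int.fract p.1, Int.fract p.2)

/-- The integral of the periodization of `φ` along the diagonal translated vertically by `w`. -/
def diagIntegral (φ : ℝ × ℝ → ℝ) (w : ℝ) : ℝ := ∫ u in (0:ℝ)..1, periodize φ (u, u + w)

section

variable {φ : ℝ × ℝ → ℝ}

lemma measurable_periodize (hφ : Continuous φ) : Measurable (periodize φ) :=
  hφ.measurable.comp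
    ((measurable_fract.comp measurable_fst).prodMk (measurable_fract.comp measurable_snd))

lemma exists_norm_periodize_le (hφ : Continuous φ) : ∃ C, ∀ p, ‖periodize φ p‖ ≤ C := by
  obtain ⟨C, hC⟩ := (isCompact_Icc.prod isCompact_Icc :
    IsCompact (Icc (0:ℝ) 1 ×ˢ Icc (0:ℝ) 1)).exists_bound_of_continuousOn hφ.continuousOn
  exact ⟨C, fun p => hC _ ⟨⟨Int.fract_nonneg _, (Int.fract_lt_one _).le⟩,
    ⟨Int.fract_nonneg _, (Int.fract_lt_one _).le⟩⟩⟩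

lemma integrable_periodize_comp {α : Type*} [MeasurableSpace α] {μ : Measure α} [IsFiniteMeasure μ]
    (hφ : Continuous φ) {f : α → ℝ × ℝ} (hf : Measurable f) :
    Integrable (fun a => periodize φ (f a)) μ := by
  obtain ⟨C, hC⟩ := exists_norm_periodize_le hφ
  exact .of_bound ((measurable_periodize hφ).comp hf).aestronglyMeasurable C
    (.of_forall fun _ => hC _)

lemma volume_restrict_unitOpenSq :
    (volume : Measure (ℝ × ℝ)).restrict unitOpenSq =
      (volume.restrict (Ioc (0:ℝ) 1)).prod (volume.restrict (Ioc (0:ℝ) 1)) := by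
  rw [← restrict_Ioo_eq_restrict_Ioc, Measure.prod_restrict]
  rfl

instance isFiniteMeasure_restrict_unitOpenSq :
    IsFiniteMeasure ((volume : Measure (ℝ × ℝ)).restrict unitOpenSq) := by
  rw [volume_restrict_unitOpenSq]
  infer_instance

lemma periodize_eq_of_mem {p : ℝ × ℝ} (hp : p ∈ unitOpenSq) : periodize φ p = φ p := by
  rw [periodize, Int.fract_eq_self.2 ⟨hp.1.1.le, hp.1.2⟩, Int.fract_eq_self.2 ⟨hp.2.1.le, hp.2.2⟩]

lemma measurableSet_unitOpenSq : MeasurableSet unitOpenSq :=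
  measurableSet_Ioo.prod measurableSet_Ioo

lemma integrableOn_unitOpenSq (hφ : Continuous φ) : IntegrableOn φ unitOpenSq :=
  (integrable_periodize_comp hφ measurable_id).congr
    ((ae_restrict_mem measurableSet_unitOpenSq).mono fun _ hp => periodize_eq_of_mem hp)

lemma periodic_periodize_diag (w : ℝ) :
    Function.Periodic (fun u => periodize φ (u, u + w)) 1 := fun u => by
  simp only [periodize, add_right_comm u 1 w, Int.fract_add_one]

lemma periodic_periodize_snd (u : ℝ) :
    Function.Periodic (fun v => periodize φ (u, v)) 1 := fun v => by
  simp only [periodize, Int.fract_add_one]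

lemma integral_comp_catF (hφ : Continuous φ) (t : ℝ) :
    ∫ p in unitOpenSq, φ (catF t p) = ∫ y in (0:ℝ)..1, diagIntegral φ ((1 - t) * y) := by
  change ∫ p in unitOpenSq, periodize φ (p.1 + p.2, p.1 + (2 - t) * p.2) = _
  rw [volume_restrict_unitOpenSq, integral_prod_symm _
    (integrable_periodize_comp hφ (by fun_prop)), ← intervalIntegral.integral_of_le zero_le_one]
  refine intervalIntegral.integral_congr fun y _ => ?_
  dsimp only
  rw [← intervalIntegral.integral_of_le zero_le_one]
  have h := intervalIntegral.integral_comp_add_right (a := 0) (b := 1)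
    (fun u => periodize φ (u, u + (1 - t) * y)) y
  rw [zero_add, add_comm 1 y, (periodic_periodize_diag _).intervalIntegral_add_eq y 0,
    zero_add] at h
  rw [diagIntegral, ← h]
  congr! 4
  ring

lemma integral_diagIntegral (hφ : Continuous φ) :
    ∫ w in (0:ℝ)..1, diagIntegral φ w = ∫ p in unitOpenSq, φ p := by
  rw [← setIntegral_congr_fun measurableSet_unitOpenSq fun p hp => periodize_eq_of_mem hp,
    volume_restrict_unitOpenSq, integral_prod (periodize φ) (integrable_periodize_comp hφ measurable_id)]
  simp only [diagIntegral, intervalIntegral.integral_of_le zero_le_one]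
  rw [integral_integral_swap (integrable_periodize_comp hφ (by fun_prop))]
  refine integral_congr_ae (.of_forall fun u => ?_)
  simp only [← intervalIntegral.integral_of_le zero_le_one]
  rw [intervalIntegral.integral_comp_add_left (fun v => periodize φ (u, v)) u, add_zero,
    (periodic_periodize_snd u).intervalIntegral_add_eq u 0, zero_add]

lemma stronglyMeasurable_diagIntegral (hφ : Continuous φ) :
    StronglyMeasurable (diagIntegral φ) := by
  have h : StronglyMeasurable fun q : ℝ × ℝ => periodize φ (q.2, q.2 + q.1) :=
    ((measurable_periodize hφ).comp (by fun_prop)).stronglyMeasurable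
  unfold diagIntegral
  simp only [intervalIntegral.integral_of_le zero_le_one]
  exact h.integral_prod_right

lemma intervalIntegrable_diagIntegral (hφ : Continuous φ) (a b : ℝ) :
    IntervalIntegrable (diagIntegral φ) volume a b := by
  obtain ⟨C, hC⟩ := exists_norm_periodize_le hφ
  refine intervalIntegrable_const (c := C) |>.mono_fun
    (stronglyMeasurable_diagIntegral hφ).aestronglyMeasurable (.of_forall fun w => ?_)
  have h := intervalIntegral.norm_integral_le_of_norm_le_const (a := 0) (b := 1)
    fun u _ => hC (u, u + w)
  rw [sub_zero, abs_one, mul_one] at h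
  exact h.trans (le_abs_self C)

lemma diagIntegral_one : diagIntegral φ 1 = ∫ s in (0:ℝ)..1, φ (s, s) := by
  simp only [diagIntegral, intervalIntegral.integral_of_le zero_le_one,
    ← restrict_Ioo_eq_restrict_Ioc]
  refine setIntegral_congr_fun measurableSet_Ioo fun u hu => ?_
  simp only [periodize, Int.fract_add_one, Int.fract_eq_self.2 ⟨hu.1.le, hu.2⟩]

lemma continuousAt_diagIntegral_one (hφ : Continuous φ) : ContinuousAt (diagIntegral φ) 1 := by
  obtain ⟨C, hC⟩ := exists_norm_periodize_le hφ
  unfold diagIntegral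
  simp only [intervalIntegral.integral_of_le zero_le_one, ← restrict_Ioo_eq_restrict_Ioc]
  refine continuousAt_of_dominated (bound := fun _ => C)
    (.of_forall fun w => ((measurable_periodize hφ).comp (by fun_prop)).aestronglyMeasurable)
    (.of_forall fun w => .of_forall fun u => hC _) (integrable_const C) ?_
  filter_upwards [ae_restrict_mem measurableSet_Ioo] with u hu
  have hfloor : ((⌊u + 1⌋ : ℤ) : ℝ) ≠ u + 1 := by
    intro h
    have := Int.self_sub_floor (u + 1)
    rw [h, sub_self, Int.fract_add_one, Int.fract_eq_self.2 ⟨hu.1.le, hu.2⟩] at this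
    exact hu.1.ne this
  have hfract : ContinuousAt (Int.fract : ℝ → ℝ) (u + 1) := continuousAt_fract hfloor.symm
  exact hφ.continuousAt.comp (continuousAt_const.prodMk
    (ContinuousAt.comp (f := fun w : ℝ => u + w) hfract (by fun_prop)))

lemma hasDerivAt_mean_diagIntegral (hφ : Continuous φ) :
    HasDerivAt (fun s : ℝ => s⁻¹ * ∫ w in (0:ℝ)..s, diagIntegral φ w)
      (diagIntegral φ 1 - ∫ w in (0:ℝ)..1, diagIntegral φ w) 1 := by
  have h := intervalIntegral.integral_hasDerivAt_right (intervalIntegrable_diagIntegral hφ 0 1)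
    (stronglyMeasurable_diagIntegral hφ).stronglyMeasurableAtFilter
    (continuousAt_diagIntegral_one hφ)
  refine ((hasDerivAt_inv (one_ne_zero (α := ℝ))).mul h).congr_deriv ?_
  ring

end

/-- `lim_{t→0⁺} t⁻¹ ∫_M (φ∘F_t − φ) dm = ∫_M φ dm − ∫₀¹ φ(s,s) ds`. -/
theorem cat_initial_response (φ : ℝ × ℝ → ℝ) (hφ : Continuous φ) :
    Tendsto (fun t : ℝ => (∫ x in unitOpenSq, (φ (catF t x) - φ x)) / t) (𝓝[>] (0:ℝ))
      (𝓝 ((∫ x in unitOpenSq, φ x) - ∫ s in (0:ℝ)..1, φ (s, s))) := by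
  have hderiv : HasDerivAt (fun t : ℝ => (1 - t)⁻¹ * ∫ w in (0:ℝ)..(1 - t), diagIntegral φ w)
      (-(diagIntegral φ 1 - ∫ w in (0:ℝ)..1, diagIntegral φ w)) 0 := by
    have h := hasDerivAt_mean_diagIntegral hφ
    rw [← sub_zero (1:ℝ)] at h
    simpa using h.comp_const_sub 1 0
  rw [integral_diagIntegral hφ, diagIntegral_one, neg_sub] at hderiv
  refine (hasDerivAt_iff_tendsto_slope_zero.1 hderiv |>.mono_left
    (nhdsWithin_mono _ fun t (ht : 0 < t) => ht.ne')).congr' ?_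
  filter_upwards [nhdsWithin_le_nhds (eventually_lt_nhds (zero_lt_one (α := ℝ)))] with t ht
  have hcat : IntegrableOn (fun p => φ (catF t p)) unitOpenSq :=
    integrable_periodize_comp hφ (f := fun p : ℝ × ℝ => (p.1 + p.2, p.1 + (2 - t) * p.2)) (by fun_prop)
  rw [integral_sub hcat (integrableOn_unitOpenSq hφ), integral_comp_catF hφ,
    intervalIntegral.integral_comp_mul_left _ (sub_pos.2 ht).ne', ← integral_diagIntegral hφ]
  simp [div_eq_inv_mul]
end
end
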